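/- arXiv:0812.1304 — 3 statements merged into one kernel-verified Lean document; each statement's English description precedes it below -/
import Mathlib

section
/- Let R be a Gorenstein hereditary commutative ring. The following statements are equivalent: (1) R is strongly Gorenstein hereditary; (2) every Gorenstein projective R-module is strongly Gorenstein projective; (3) R is coherent and every Gorenstein flat R-module is strongly Gorenstein flat. -/
noncomputable section

universe u

variable (R : Type u) [CommRing R]

/-- `IsShortExact R f g` says that `0 → A → B → C → 0` is a short exact sequence. -/
def IsShortExact {A B C : Type u} [AddCommGroup A] [Module R A] [AddCommGroup B] [Module R B]
    [AddCommGroup C] [Module R C] (f : A →ₗ[R] B) (g : B →ₗ[R] C) : Prop :=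
  Function.Injective f ∧ Function.Surjective g ∧ LinearMap.range f = LinearMap.ker g

/-- A module `M` is Gorenstein projective if there is a complete projective resolution
`⋯ → P i → P (i+1) → ⋯` (an exact sequence of projective modules which remains exact after
applying `Hom(-, Q)` for every projective module `Q`) with `M ≅ Im (P 0 → P 1)`. -/
def IsGorensteinProjective (M : Type u) [AddCommGroup M] [Module R M] : Prop :=
  ∃ (P : ℤ → Type u) (_ : ∀ i, AddCommGroup (P i)) (_ : ∀ i, Module R (P i))
    (d : ∀ i, P i →ₗ[R] P (i + 1)),
    (∀ i, Module.Projective R (P i)) ∧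
    (∀ i, LinearMap.range (d i) = LinearMap.ker (d (i + 1))) ∧
    Nonempty (M ≃ₗ[R] LinearMap.range (d 0)) ∧
    (∀ (Q : Type u) (_ : AddCommGroup Q) (_ : Module R Q), Module.Projective R Q →
      ∀ (i : ℤ) (g : P (i + 1) →ₗ[R] Q), g.comp (d i) = 0 →
        ∃ h : P (i + 1 + 1) →ₗ[R] Q, h.comp (d (i + 1)) = g)

/-- A module `M` is strongly Gorenstein projective if there is a complete projective
resolution of the form `⋯ → P →f P →f P → ⋯` with `M ≅ Im f`. -/
def IsStronglyGorensteinProjective (M : Type u) [AddCommGroup M] [Module R M] : Prop :=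
  ∃ (P : Type u) (_ : AddCommGroup P) (_ : Module R P) (f : P →ₗ[R] P),
    Module.Projective R P ∧
    LinearMap.range f = LinearMap.ker f ∧
    Nonempty (M ≃ₗ[R] LinearMap.range f) ∧
    (∀ (Q : Type u) (_ : AddCommGroup Q) (_ : Module R Q), Module.Projective R Q →
      ∀ g : P →ₗ[R] Q, g.comp f = 0 → ∃ h : P →ₗ[R] Q, h.comp f = g)

/-- A module `M` is Gorenstein flat if there is an exact sequence of flat modules
`⋯ → F i → F (i+1) → ⋯` which remains exact after applying `- ⊗ I` for every injective
module `I`, with `M ≅ Im (F 0 → F 1)`. -/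
def IsGorensteinFlat (M : Type u) [AddCommGroup M] [Module R M] : Prop :=
  ∃ (F : ℤ → Type u) (_ : ∀ i, AddCommGroup (F i)) (_ : ∀ i, Module R (F i))
    (d : ∀ i, F i →ₗ[R] F (i + 1)),
    (∀ i, Module.Flat R (F i)) ∧
    (∀ i, LinearMap.range (d i) = LinearMap.ker (d (i + 1))) ∧
    Nonempty (M ≃ₗ[R] LinearMap.range (d 0)) ∧
    (∀ (I : Type u) (_ : AddCommGroup I) (_ : Module R I), Module.Injective R I →
      ∀ i : ℤ, LinearMap.range (LinearMap.rTensor I (d i)) =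
        LinearMap.ker (LinearMap.rTensor I (d (i + 1))))

/-- A module `M` is strongly Gorenstein flat if there is an exact sequence of flat modules
of the form `⋯ → F →f F →f F → ⋯` which remains exact after applying `- ⊗ I` for every
injective module `I`, with `M ≅ Im f`. -/
def IsStronglyGorensteinFlat (M : Type u) [AddCommGroup M] [Module R M] : Prop :=
  ∃ (F : Type u) (_ : AddCommGroup F) (_ : Module R F) (f : F →ₗ[R] F),
    Module.Flat R F ∧
    LinearMap.range f = LinearMap.ker f ∧
    Nonempty (M ≃ₗ[R] LinearMap.range f) ∧
    (∀ (I : Type u) (_ : AddCommGroup I) (_ : Module R I), Module.Injective R I →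
      LinearMap.range (LinearMap.rTensor I f) = LinearMap.ker (LinearMap.rTensor I f))

/-- `ProjDimLE R M n` : the projective dimension of `M` is at most `n`, i.e. there is an exact
sequence `0 → P n → ⋯ → P 0 → M → 0` with each `P i` projective. -/
def ProjDimLE (M : Type u) [AddCommGroup M] [Module R M] (n : ℕ) : Prop :=
  ∃ (P : ℕ → Type u) (_ : ∀ i, AddCommGroup (P i)) (_ : ∀ i, Module R (P i))
    (d : ∀ i, P (i + 1) →ₗ[R] P i) (ε : P 0 →ₗ[R] M),
    (∀ i, Module.Projective R (P i)) ∧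
    (∀ i, n < i → Subsingleton (P i)) ∧
    Function.Surjective ε ∧
    LinearMap.ker ε = LinearMap.range (d 0) ∧
    (∀ i, LinearMap.ker (d i) = LinearMap.range (d (i + 1)))

/-- `InjDimLE R M n` : the injective dimension of `M` is at most `n`, i.e. there is an exact
sequence `0 → M → E 0 → ⋯ → E n → 0` with each `E i` injective. -/
def InjDimLE (M : Type u) [AddCommGroup M] [Module R M] (n : ℕ) : Prop :=
  ∃ (E : ℕ → Type u) (_ : ∀ i, AddCommGroup (E i)) (_ : ∀ i, Module R (E i))
    (d : ∀ i, E i →ₗ[R] E (i + 1)) (η : M →ₗ[R] E 0),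
    (∀ i, Module.Injective R (E i)) ∧
    (∀ i, n < i → Subsingleton (E i)) ∧
    Function.Injective η ∧
    LinearMap.range η = LinearMap.ker (d 0) ∧
    (∀ i, LinearMap.range (d i) = LinearMap.ker (d (i + 1)))

/-- `FlatDimLE R M n` : the flat dimension of `M` is at most `n`. -/
def FlatDimLE (M : Type u) [AddCommGroup M] [Module R M] (n : ℕ) : Prop :=
  ∃ (F : ℕ → Type u) (_ : ∀ i, AddCommGroup (F i)) (_ : ∀ i, Module R (F i))
    (d : ∀ i, F (i + 1) →ₗ[R] F i) (ε : F 0 →ₗ[R] M),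
    (∀ i, Module.Flat R (F i)) ∧
    (∀ i, n < i → Subsingleton (F i)) ∧
    Function.Surjective ε ∧
    LinearMap.ker ε = LinearMap.range (d 0) ∧
    (∀ i, LinearMap.ker (d i) = LinearMap.range (d (i + 1)))

/-- `GProjDimLE R M n` : the Gorenstein projective dimension of `M` is at most `n`, i.e.
there is an exact sequence `0 → G n → ⋯ → G 0 → M → 0` with each `G i` Gorenstein
projective. -/
def GProjDimLE (M : Type u) [AddCommGroup M] [Module R M] (n : ℕ) : Prop :=
  ∃ (G : ℕ → Type u) (_ : ∀ i, AddCommGroup (G i)) (_ : ∀ i, Module R (G i))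
    (d : ∀ i, G (i + 1) →ₗ[R] G i) (ε : G 0 →ₗ[R] M),
    (∀ i, IsGorensteinProjective R (G i)) ∧
    (∀ i, n < i → Subsingleton (G i)) ∧
    Function.Surjective ε ∧
    LinearMap.ker ε = LinearMap.range (d 0) ∧
    (∀ i, LinearMap.ker (d i) = LinearMap.range (d (i + 1)))

/-- `GFlatDimLE R M n` : the Gorenstein flat dimension of `M` is at most `n`. -/
def GFlatDimLE (M : Type u) [AddCommGroup M] [Module R M] (n : ℕ) : Prop :=
  ∃ (G : ℕ → Type u) (_ : ∀ i, AddCommGroup (G i)) (_ : ∀ i, Module R (G i))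
    (d : ∀ i, G (i + 1) →ₗ[R] G i) (ε : G 0 →ₗ[R] M),
    (∀ i, IsGorensteinFlat R (G i)) ∧
    (∀ i, n < i → Subsingleton (G i)) ∧
    Function.Surjective ε ∧
    LinearMap.ker ε = LinearMap.range (d 0) ∧
    (∀ i, LinearMap.ker (d i) = LinearMap.range (d (i + 1)))

/-- A module is finitely presented if it is the quotient of a finite free module by a
finitely generated submodule of relations. -/
def IsFinitelyPresented (M : Type u) [AddCommGroup M] [Module R M] : Prop :=
  ∃ (n : ℕ) (f : (Fin n → R) →ₗ[R] M), Function.Surjective f ∧ (LinearMap.ker f).FG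

/-- A ring is coherent if every finitely generated ideal is finitely presented. -/
def IsCoherentRing : Prop :=
  ∀ I : Ideal R, I.FG → IsFinitelyPresented R I

/-- `ExtVanishes R M N i` : `Ext_R^i(M, N) = 0`. -/
def ExtVanishes (M N : Type u) [AddCommGroup M] [Module R M] [AddCommGroup N] [Module R N]
    (i : ℕ) : Prop :=
  Subsingleton (((Ext R (ModuleCat.{u} R) i).obj
    (Opposite.op (ModuleCat.of R M))).obj (ModuleCat.of R N))

/-- A ring is hereditary if every submodule of a projective module is projective. -/
def IsHereditaryRing : Prop :=
  ∀ (P : Type u) (_ : AddCommGroup P) (_ : Module R P), Module.Projective R P →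
    ∀ N : Submodule R P, Module.Projective R N

/-- A ring is semihereditary if every finitely generated ideal is projective. -/
def IsSemihereditaryRing : Prop :=
  ∀ I : Ideal R, I.FG → Module.Projective R I

/-- A ring is Gorenstein hereditary if every submodule of a projective module is
Gorenstein projective. -/
def IsGHereditaryRing : Prop :=
  ∀ (P : Type u) (_ : AddCommGroup P) (_ : Module R P), Module.Projective R P →
    ∀ N : Submodule R P, IsGorensteinProjective R N

/-- A ring is strongly Gorenstein hereditary if every submodule of a projective module is
strongly Gorenstein projective. -/
def IsSGHereditaryRing : Prop :=
  ∀ (P : Type u) (_ : AddCommGroup P) (_ : Module R P), Module.Projective R P →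
    ∀ N : Submodule R P, IsStronglyGorensteinProjective R N

/-- A ring is Gorenstein semihereditary if it is coherent and every submodule of a flat
module is Gorenstein flat. -/
def IsGSemihereditaryRing : Prop :=
  IsCoherentRing R ∧
    ∀ (F : Type u) (_ : AddCommGroup F) (_ : Module R F), Module.Flat R F →
      ∀ N : Submodule R F, IsGorensteinFlat R N

/-- A ring is strongly Gorenstein semihereditary if it is coherent and every submodule of a
flat module is strongly Gorenstein flat. -/
def IsSGSemihereditaryRing : Prop :=
  IsCoherentRing R ∧
    ∀ (F : Type u) (_ : AddCommGroup F) (_ : Module R F), Module.Flat R F →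
      ∀ N : Submodule R F, IsStronglyGorensteinFlat R N

section

variable {R}

section LinearAlgebraHelpers

variable {A B C D E I : Type*} [AddCommGroup A] [Module R A] [AddCommGroup B] [Module R B]
  [AddCommGroup C] [Module R C] [AddCommGroup D] [Module R D] [AddCommGroup E] [Module R E]
  [AddCommGroup I] [Module R I]

/-- A linear map vanishing on the kernel of a surjection factors through it. -/
lemma exists_comp_eq_of_surjective {s : A →ₗ[R] B} (hs : Function.Surjective s) {g : A →ₗ[R] C}
    (hg : LinearMap.ker s ≤ LinearMap.ker g) : ∃ g' : B →ₗ[R] C, g' ∘ₗ s = g := by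
  refine ⟨(LinearMap.ker s).liftQ g hg ∘ₗ (s.quotKerEquivOfSurjective hs).symm.toLinearMap, ?_⟩
  ext x
  simp [LinearMap.quotKerEquivOfSurjective_symm_apply]

/-- A linear map with values in the range of an injection factors through it. -/
lemma exists_comp_eq_of_injective {j : A →ₗ[R] B} (hj : Function.Injective j) {g : C →ₗ[R] B}
    (hg : LinearMap.range g ≤ LinearMap.range j) : ∃ g' : C →ₗ[R] A, j ∘ₗ g' = g := by
  refine ⟨(LinearEquiv.ofInjective j hj).symm.toLinearMap ∘ₗ
    g.codRestrict _ fun c => hg (LinearMap.mem_range_self g c), ?_⟩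
  ext x
  exact congrArg Subtype.val ((LinearEquiv.ofInjective j hj).apply_symm_apply _)

end LinearAlgebraHelpers

/-- The module `M` is isomorphic to a submodule of a projective module. -/
def EmbedsInProjective (M : Type*) [AddCommGroup M] [Module R M] : Prop :=
  ∃ (P : Type u) (_ : AddCommGroup P) (_ : Module R P) (i : M →ₗ[R] P),
    Module.Projective R P ∧ Function.Injective i

lemma IsGorensteinProjective.of_equiv {M N : Type u} [AddCommGroup M] [Module R M]
    [AddCommGroup N] [Module R N] (hM : IsGorensteinProjective R M) (e : M ≃ₗ[R] N) :
    IsGorensteinProjective R N := by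
  obtain ⟨P, i1, i2, d, hP, hd, ⟨e'⟩, hQ⟩ := hM
  exact ⟨P, i1, i2, d, hP, hd, ⟨e.symm.trans e'⟩, hQ⟩

lemma IsStronglyGorensteinProjective.of_equiv {M N : Type u} [AddCommGroup M] [Module R M]
    [AddCommGroup N] [Module R N] (hM : IsStronglyGorensteinProjective R M) (e : M ≃ₗ[R] N) :
    IsStronglyGorensteinProjective R N := by
  obtain ⟨P, i1, i2, f, hP, hf, ⟨e'⟩, hQ⟩ := hM
  exact ⟨P, i1, i2, f, hP, hf, ⟨e.symm.trans e'⟩, hQ⟩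

/-- A Gorenstein projective module is the kernel of a map between projective modules. -/
lemma IsGorensteinProjective.exists_exact {M : Type u} [AddCommGroup M] [Module R M]
    (hM : IsGorensteinProjective R M) :
    ∃ (P : Type u) (_ : AddCommGroup P) (_ : Module R P) (P' : Type u) (_ : AddCommGroup P')
      (_ : Module R P') (i : M →ₗ[R] P) (d : P →ₗ[R] P'), Module.Projective R P ∧
      Module.Projective R P' ∧ Function.Injective i ∧ LinearMap.range i = LinearMap.ker d := by
  obtain ⟨P, i1, i2, d, hP, hd, ⟨e⟩, -⟩ := hM
  refine ⟨P (0 + 1), i1 _, i2 _, P (0 + 1 + 1), i1 _, i2 _,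
    (LinearMap.range (d 0)).subtype ∘ₗ e.toLinearMap, d (0 + 1), hP _, hP _, ?_, ?_⟩
  · exact (Submodule.subtype_injective _).comp e.injective
  · rw [LinearMap.range_comp_of_range_eq_top _ e.range, Submodule.range_subtype, hd]

lemma IsGorensteinProjective.embedsInProjective {M : Type u} [AddCommGroup M] [Module R M]
    (hM : IsGorensteinProjective R M) : EmbedsInProjective (R := R) M := by
  obtain ⟨P, _, _, P', _, _, i, d, hP, -, hi, -⟩ := hM.exists_exact
  exact ⟨P, _, _, i, hP, hi⟩

/-- `Ext¹(M, Q) = 0` for `M` Gorenstein projective and `Q` projective, stated as an extension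
property for maps. -/
lemma IsGorensteinProjective.exists_extension {M : Type u} [AddCommGroup M] [Module R M]
    (hM : IsGorensteinProjective R M) {A B : Type*} [AddCommGroup A] [Module R A]
    [AddCommGroup B] [Module R B] {Q : Type u} [AddCommGroup Q] [Module R Q]
    [Module.Projective R Q] {j : A →ₗ[R] B} {p : B →ₗ[R] M} (hj : Function.Injective j)
    (hp : Function.Surjective p) (hjp : LinearMap.range j = LinearMap.ker p) (φ : A →ₗ[R] Q) :
    ∃ ψ : B →ₗ[R] Q, ψ ∘ₗ j = φ := by
  obtain ⟨P, i1, i2, d, hP, hd, ⟨e⟩, hQ⟩ := hM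
  obtain ⟨P₂, _, _, P₁, _, _, P₀, _, _, d₂, d₁, c, hP₁, hP₀, hc, h21, h10, hQ⟩ :
      ∃ (P₂ : Type u) (_ : AddCommGroup P₂) (_ : Module R P₂) (P₁ : Type u) (_ : AddCommGroup P₁)
        (_ : Module R P₁) (P₀ : Type u) (_ : AddCommGroup P₀) (_ : Module R P₀)
        (d₂ : P₂ →ₗ[R] P₁) (d₁ : P₁ →ₗ[R] P₀) (c : P₀ →ₗ[R] M), Module.Projective R P₁ ∧
        Module.Projective R P₀ ∧ Function.Surjective c ∧ LinearMap.range d₂ = LinearMap.ker d₁ ∧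
        LinearMap.range d₁ = LinearMap.ker c ∧
        ∀ g : P₁ →ₗ[R] Q, g ∘ₗ d₂ = 0 → ∃ h : P₀ →ₗ[R] Q, h ∘ₗ d₁ = g := by
    refine ⟨P (-2), _, _, P (-2 + 1), _, _, P (-2 + 1 + 1), _, _, d (-2), d (-2 + 1),
      e.symm.toLinearMap ∘ₗ (d 0).rangeRestrict, hP _, hP _,
      e.symm.surjective.comp (d 0).surjective_rangeRestrict, hd _, ?_, hQ Q _ _ ‹_› (-2)⟩
    rw [LinearMap.ker_comp_of_ker_eq_bot _ e.symm.ker, LinearMap.ker_rangeRestrict]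
    exact hd (-2 + 1)
  obtain ⟨c', hc'⟩ := Module.projective_lifting_property p c hp
  have hc'' (x) : p (c' x) = c x := LinearMap.congr_fun hc' x
  have hd21 (x) : d₁ (d₂ x) = 0 := by
    have : d₂ x ∈ LinearMap.ker d₁ := h21 ▸ LinearMap.mem_range_self d₂ x
    simpa using this
  have hd10 (x) : c (d₁ x) = 0 := by
    have : d₁ x ∈ LinearMap.ker c := h10 ▸ LinearMap.mem_range_self d₁ x
    simpa using this
  obtain ⟨a, ha⟩ := exists_comp_eq_of_injective hj (g := c' ∘ₗ d₁) (by
    rw [hjp]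
    rintro _ ⟨x, rfl⟩
    simp [hc'', hd10])
  have ha' (x) : j (a x) = c' (d₁ x) := LinearMap.congr_fun ha x
  obtain ⟨k, hk⟩ := hQ (φ ∘ₗ a) (by
    ext x
    have : a (d₂ x) = 0 := hj (by simp [ha', hd21])
    simp [this])
  have hk' (x) : k (d₁ x) = φ (a x) := LinearMap.congr_fun hk x
  obtain ⟨ψ, hψ⟩ := exists_comp_eq_of_surjective (s := j.coprod c') (g := φ.coprod k) (by
    intro b
    obtain ⟨x, hx⟩ := hc (p b)
    have : b - c' x ∈ LinearMap.range j := by rw [hjp]; simp [hc'', hx]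
    obtain ⟨y, hy⟩ := this
    exact ⟨(y, x), by simp [hy]⟩) (by
    rintro ⟨y, x⟩ hyx
    have hyx' : j y + c' x = 0 := by simpa using hyx
    have hx : x ∈ LinearMap.range d₁ := by
      have hpj : p (j y) = 0 := by
        have : j y ∈ LinearMap.ker p := hjp ▸ LinearMap.mem_range_self j y
        simpa using this
      rw [h10, LinearMap.mem_ker, ← hc'']
      simpa [hpj] using congrArg p hyx'
    obtain ⟨z, rfl⟩ := hx
    have : y = - a z := hj (by rw [map_neg, ha']; exact eq_neg_of_add_eq_zero_left hyx')
    simp [hk', this])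
  refine ⟨ψ, ?_⟩
  ext x
  simpa using LinearMap.congr_fun hψ (x, 0)

lemma EmbedsInProjective.of_injective {M N : Type*} [AddCommGroup M] [Module R M]
    [AddCommGroup N] [Module R N] (hN : EmbedsInProjective (R := R) N) (f : M →ₗ[R] N)
    (hf : Function.Injective f) : EmbedsInProjective (R := R) M := by
  obtain ⟨P, _, _, i, hP, hi⟩ := hN
  exact ⟨P, _, _, i ∘ₗ f, hP, hi.comp hf⟩

lemma EmbedsInProjective.of_projective (P : Type u) [AddCommGroup P] [Module R P]
    [Module.Projective R P] : EmbedsInProjective (R := R) P :=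
  ⟨P, _, _, LinearMap.id, ‹_›, Function.injective_id⟩

lemma EmbedsInProjective.submodule {P : Type u} [AddCommGroup P] [Module R P]
    [Module.Projective R P] (N : Submodule R P) : EmbedsInProjective (R := R) N :=
  ⟨P, _, _, N.subtype, ‹_›, N.subtype_injective⟩

lemma EmbedsInProjective.prod {M N : Type*} [AddCommGroup M] [Module R M]
    [AddCommGroup N] [Module R N] (hM : EmbedsInProjective (R := R) M)
    (hN : EmbedsInProjective (R := R) N) : EmbedsInProjective (R := R) (M × N) := by
  obtain ⟨P, _, _, i, hP, hi⟩ := hM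
  obtain ⟨Q, _, _, j, hQ, hj⟩ := hN
  exact ⟨P × Q, _, _, i.prodMap j, inferInstance, Prod.map_injective.mpr ⟨hi, hj⟩⟩

lemma EmbedsInProjective.isGorensteinProjective (h : IsGHereditaryRing R) {M : Type u}
    [AddCommGroup M] [Module R M] (hM : EmbedsInProjective (R := R) M) :
    IsGorensteinProjective R M := by
  obtain ⟨P, _, _, i, hP, hi⟩ := hM
  exact (h P _ _ hP (LinearMap.range i)).of_equiv (LinearEquiv.ofInjective i hi).symm

/-- Over a Gorenstein hereditary ring, submodules of projective modules are closed under
extensions. -/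
lemma EmbedsInProjective.of_exact (h : IsGHereditaryRing R) {A B C : Type u}
    [AddCommGroup A] [Module R A] [AddCommGroup B] [Module R B] [AddCommGroup C] [Module R C]
    {j : A →ₗ[R] B} {p : B →ₗ[R] C} (hj : Function.Injective j) (hp : Function.Surjective p)
    (hjp : LinearMap.range j = LinearMap.ker p) (hA : EmbedsInProjective (R := R) A)
    (hC : EmbedsInProjective (R := R) C) : EmbedsInProjective (R := R) B := by
  obtain ⟨P, _, _, i, hP, hi⟩ := hA
  obtain ⟨ψ, hψ⟩ := (hC.isGorensteinProjective h).exists_extension hj hp hjp i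
  refine ((EmbedsInProjective.of_projective P).prod hC).of_injective (ψ.prod p) ?_
  rw [injective_iff_map_eq_zero]
  intro b hb
  have hb' : ψ b = 0 ∧ p b = 0 := by simpa using hb
  obtain ⟨a, rfl⟩ : b ∈ LinearMap.range j := hjp ▸ hb'.2
  have : i a = 0 := by rw [← hψ]; exact hb'.1
  rw [hi (this.trans (map_zero i).symm), map_zero]

/-- Over a Gorenstein hereditary ring, every module is the quotient of a submodule of a projective
module by a projective submodule. -/
lemma IsGHereditaryRing.exists_surjective_ker_projective (h : IsGHereditaryRing R) (M : Type u)
    [AddCommGroup M] [Module R M] :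
    ∃ (P : Type u) (_ : AddCommGroup P) (_ : Module R P) (G : Submodule R P) (π : G →ₗ[R] M),
      Module.Projective R P ∧ Function.Surjective π ∧
      Module.Projective R (LinearMap.ker π) := by
  let Q := M →₀ R
  let q : Q →ₗ[R] M := Finsupp.linearCombination R id
  have hq : Function.Surjective q := Finsupp.linearCombination_surjective _ Function.surjective_id
  obtain ⟨P, _, _, P', _, _, i, d, hP, hP', hi, hid⟩ :=
    (h Q _ _ inferInstance (LinearMap.ker q)).exists_exact
  have hd : IsGorensteinProjective R (LinearMap.range d) := h P' _ _ hP' _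
  obtain ⟨e, he⟩ := hd.exists_extension (A := LinearMap.ker q) (Q := Q) hi d.surjective_rangeRestrict
    (hid.trans (LinearMap.ker_rangeRestrict d).symm) (LinearMap.ker q).subtype
  have he' (x) : e (i x) = x := LinearMap.congr_fun he x
  have hdi (x) : d (i x) = 0 := by
    have : i x ∈ LinearMap.ker d := hid ▸ LinearMap.mem_range_self i x
    simpa using this
  let G : Submodule R (Q × P') := (LinearMap.range d).comap (LinearMap.snd R Q P')
  let s : Q × P →ₗ[R] G := (LinearMap.prodMap LinearMap.id d).codRestrict G fun x => by simp [G]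
  have hs : Function.Surjective s := by
    rintro ⟨⟨x, z⟩, y, hy⟩
    exact ⟨(x, y), Subtype.ext (Prod.ext rfl hy)⟩
  have hs0 (x : Q) (y : P) : s (x, y) = 0 ↔ x = 0 ∧ d y = 0 := by
    have : (s (x, y) : Q × P') = (x, d y) := rfl
    rw [Subtype.ext_iff, this]
    exact Prod.ext_iff
  obtain ⟨π, hπ⟩ := exists_comp_eq_of_surjective (A := Q × P) (B := G) hs (g := q.coprod (-(q ∘ₗ e))) (by
    rintro ⟨x, y⟩ hxy
    obtain ⟨rfl, hy⟩ := (hs0 x y).1 hxy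
    obtain ⟨z, rfl⟩ : y ∈ LinearMap.range i := hid ▸ hy
    simp [he'])
  have hπ' (x y) : π (s (x, y)) = q x - q (e y) := by
    simpa [sub_eq_add_neg] using LinearMap.congr_fun hπ (x, y)
  let t : P →ₗ[R] LinearMap.ker π := (s ∘ₗ e.prod LinearMap.id).codRestrict _ fun y => by
    simp [hπ']
  have ht : Function.Bijective t := by
    constructor
    · rw [injective_iff_map_eq_zero]
      intro y hy
      have : s (e y, y) = 0 := congrArg Subtype.val hy
      obtain ⟨h1, h2⟩ := (hs0 _ _).1 this
      obtain ⟨z, rfl⟩ : y ∈ LinearMap.range i := hid ▸ h2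
      rw [he'] at h1
      rw [show z = 0 from Subtype.ext h1, map_zero]
    · rintro ⟨g, hg⟩
      obtain ⟨⟨x, y⟩, rfl⟩ := hs g
      have hxy : q (x - e y) = 0 := by rw [map_sub, ← hπ']; exact hg
      refine ⟨y + i ⟨x - e y, hxy⟩, Subtype.ext ?_⟩
      have : s (0, i ⟨x - e y, hxy⟩) = 0 := (hs0 _ _).2 ⟨rfl, hdi _⟩
      have h2 : t (y + i ⟨x - e y, hxy⟩) = s (x, y) + s (0, i ⟨x - e y, hxy⟩) := by
        change s (e (y + i ⟨x - e y, hxy⟩), y + i ⟨x - e y, hxy⟩) = _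
        rw [← map_add s, map_add e, he', Prod.mk_add_mk, add_zero, add_sub_cancel]
      rw [h2, this, add_zero]
  refine ⟨Q × P', _, _, G, π, inferInstance, ?_, ?_⟩
  · intro m
    obtain ⟨x, rfl⟩ := hq m
    exact ⟨s (x, 0), by simp [hπ']⟩
  · exact Module.Projective.of_equiv (LinearEquiv.ofBijective t ht)

section Coherence

lemma Submodule.FG.exists_finset_le_supported {X : Type*} {N : Submodule R (X →₀ R)}
    (hN : N.FG) : ∃ T : Finset X, N ≤ Finsupp.supported R R (T : Set X) := by
  classical
  obtain ⟨S, rfl⟩ := hN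
  refine ⟨S.biUnion Finsupp.support, Submodule.span_le.2 fun v hv => ?_⟩
  rw [SetLike.mem_coe, Finsupp.mem_supported]
  exact_mod_cast Finset.subset_biUnion_of_mem Finsupp.support hv

instance finite_supported_finset {X : Type*} (T : Finset X) :
    Module.Finite R (Finsupp.supported R R (T : Set X)) :=
  Module.Finite.equiv (Finsupp.supportedEquivFinsupp (M := R) (R := R) (T : Set X)).symm

instance free_supported {X : Type*} (S : Set X) :
    Module.Free R (Finsupp.supported R R S) :=
  Module.Free.of_equiv (Finsupp.supportedEquivFinsupp (M := R) (R := R) S).symm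

/-- A finitely generated submodule of a projective module over a Gorenstein hereditary ring is the
kernel of a map from a finite free module to a projective module. -/
lemma EmbedsInProjective.exists_exact_finite_free (h : IsGHereditaryRing R) {M : Type u}
    [AddCommGroup M] [Module R M] [Module.Finite R M] (hM : EmbedsInProjective (R := R) M) :
    ∃ (V : Type u) (_ : AddCommGroup V) (_ : Module R V) (P' : Type u) (_ : AddCommGroup P')
      (_ : Module R P') (j : M →ₗ[R] V) (k : V →ₗ[R] P'), Module.Finite R V ∧ Module.Free R V ∧
      Module.Projective R P' ∧ Function.Injective j ∧ LinearMap.range j = LinearMap.ker k := by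
  obtain ⟨P, _, _, P', _, _, i, d, hP, hP', hi, hid⟩ :=
    (hM.isGorensteinProjective h).exists_exact
  obtain ⟨s, hs⟩ := Module.projective_def'.1 hP
  set π : (P →₀ R) →ₗ[R] P := Finsupp.linearCombination R id
  have hs' (x) : π (s x) = x := LinearMap.congr_fun hs x
  have hdi (x) : d (i x) = 0 := by
    have : i x ∈ LinearMap.ker d := hid ▸ LinearMap.mem_range_self i x
    simpa using this
  obtain ⟨T, hT⟩ := (Module.Finite.iff_fg.1 (Module.Finite.range (s ∘ₗ i))).exists_finset_le_supported
  refine ⟨Finsupp.supported R R (T : Set P), inferInstance, inferInstance, P' × (P →₀ R),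
    inferInstance, inferInstance,
    (s ∘ₗ i).codRestrict _ fun m => hT (LinearMap.mem_range_self _ m),
    ((d ∘ₗ π).prod (LinearMap.id - s ∘ₗ π)) ∘ₗ Submodule.subtype _, inferInstance, inferInstance,
    inferInstance, ?_, ?_⟩
  · intro x y hxy
    have : s (i x) = s (i y) := congrArg Subtype.val hxy
    exact hi (by rw [← hs' (i x), this, hs'])
  · ext ⟨v, hv⟩
    simp only [LinearMap.mem_range, LinearMap.mem_ker, Subtype.ext_iff]
    constructor
    · rintro ⟨m, hm⟩
      have hm' : s (i m) = v := hm
      subst hm'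
      simp [hs', hdi]
    · intro hv
      have hv' : d (π v) = 0 ∧ v - s (π v) = 0 := by simpa using hv
      obtain ⟨m, hm⟩ : π v ∈ LinearMap.range i := hid ▸ hv'.1
      exact ⟨m, by rw [sub_eq_zero] at hv'; simpa [hm] using hv'.2.symm⟩

variable {M V P' : Type u} [AddCommGroup M] [Module R M] [AddCommGroup V] [Module R V]
  [AddCommGroup P'] [Module R P']

/-- Linear forms extend along the kernel of a map between projective modules. -/
lemma dualMap_surjective_of_range_eq_ker (h : IsGHereditaryRing R) [Module.Projective R P']
    {j : M →ₗ[R] V} {k : V →ₗ[R] P'} (hj : Function.Injective j)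
    (hjk : LinearMap.range j = LinearMap.ker k) : Function.Surjective j.dualMap := by
  intro φ
  obtain ⟨ψ, hψ⟩ := (h P' _ _ ‹_› (LinearMap.range k)).exists_extension (j := j)
    (p := k.rangeRestrict) hj k.surjective_rangeRestrict
    (by rw [hjk, LinearMap.ker_rangeRestrict]) φ
  exact ⟨ψ, hψ⟩

lemma finite_dual (h : IsGHereditaryRing R) [Module.Finite R M]
    (hM : EmbedsInProjective (R := R) M) : Module.Finite R (Module.Dual R M) := by
  obtain ⟨V, _, _, P', _, _, j, k, _, _, _, hj, hjk⟩ := hM.exists_exact_finite_free h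
  exact Module.Finite.of_surjective _ (dualMap_surjective_of_range_eq_ker h hj hjk)

lemma embedsInProjective_dual [Module.Finite R M] :
    EmbedsInProjective (R := R) (Module.Dual R M) := by
  obtain ⟨n, f, hf⟩ := Module.Finite.exists_fin' R M
  exact (EmbedsInProjective.of_projective (Module.Dual R (Fin n → R))).of_injective f.dualMap
    (LinearMap.dualMap_injective_of_surjective hf)

lemma finitePresentation_dual (h : IsGHereditaryRing R) [Module.Finite R M]
    (hM : EmbedsInProjective (R := R) M) : Module.FinitePresentation R (Module.Dual R M) := by
  obtain ⟨V, _, _, P', _, _, j, k, _, _, _, hj, hjk⟩ := hM.exists_exact_finite_free h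
  have := Module.finitePresentation_of_projective R (Module.Dual R V)
  refine Module.finitePresentation_of_surjective _ (dualMap_surjective_of_range_eq_ker h hj hjk) ?_
  have := finite_dual h (M := LinearMap.range k) (EmbedsInProjective.submodule _)
  have hk : LinearMap.ker j.dualMap = LinearMap.range k.rangeRestrict.dualMap := by
    ext φ
    constructor
    · intro hφ
      obtain ⟨χ, hχ⟩ := exists_comp_eq_of_surjective k.surjective_rangeRestrict (g := φ) (by
        rw [LinearMap.ker_rangeRestrict, ← hjk]
        rintro _ ⟨x, rfl⟩
        exact LinearMap.congr_fun hφ x)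
      exact ⟨χ, hχ⟩
    · rintro ⟨χ, rfl⟩
      ext x
      have : j x ∈ LinearMap.ker k := hjk ▸ LinearMap.mem_range_self j x
      have : k.rangeRestrict (j x) = 0 := Subtype.ext this
      simp [this]
  rw [hk]
  exact Module.Finite.iff_fg.1 (Module.Finite.range _)

/-- Finitely generated submodules of projective modules over a Gorenstein hereditary ring are
finitely presented. -/
lemma EmbedsInProjective.finitePresentation (h : IsGHereditaryRing R) [Module.Finite R M]
    (hM : EmbedsInProjective (R := R) M) : Module.FinitePresentation R M := by
  obtain ⟨V, _, _, P', _, _, j, k, _, _, _, hj, hjk⟩ := hM.exists_exact_finite_free h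
  have := finite_dual h hM
  have := finitePresentation_dual h (M := Module.Dual R M) embedsInProjective_dual
  refine Module.FinitePresentation.of_equiv (LinearEquiv.ofBijective (Module.Dual.eval R M)
    ⟨?_, ?_⟩).symm
  · rw [injective_iff_map_eq_zero]
    intro m hm
    refine hj ?_
    rw [map_zero, ← Module.forall_dual_apply_eq_zero_iff R]
    exact fun f => LinearMap.congr_fun hm (f ∘ₗ j)
  · intro Θ
    obtain ⟨v, hv⟩ := (Module.evalEquiv R V).surjective (Θ ∘ₗ j.dualMap)
    have hv' (χ : Module.Dual R V) : χ v = Θ (χ ∘ₗ j) := LinearMap.congr_fun hv χ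
    have hk : k v = 0 := by
      rw [← Module.forall_dual_apply_eq_zero_iff R]
      intro χ
      have : (χ ∘ₗ k) ∘ₗ j = 0 := by
        ext x
        have : j x ∈ LinearMap.ker k := hjk ▸ LinearMap.mem_range_self j x
        simp [LinearMap.mem_ker.1 this]
      exact (hv' (χ ∘ₗ k)).trans (by rw [this, map_zero])
    obtain ⟨m, rfl⟩ : v ∈ LinearMap.range j := hjk ▸ hk
    refine ⟨m, ?_⟩
    ext φ
    obtain ⟨ψ, rfl⟩ := dualMap_surjective_of_range_eq_ker h hj hjk φ
    exact hv' ψ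

lemma IsGHereditaryRing.isCoherentRing (h : IsGHereditaryRing R) : IsCoherentRing R := by
  intro I hI
  have : Module.Finite R I := Module.Finite.iff_fg.2 hI
  have : Module.FinitePresentation R I := (EmbedsInProjective.submodule I).finitePresentation h
  obtain ⟨n, f, hf⟩ := Module.Finite.exists_fin' R I
  exact ⟨n, f, hf, Module.FinitePresentation.fg_ker f hf⟩

end Coherence

section Tor

open TensorProduct

variable {A B C A' B' C' : Type*} [AddCommGroup A] [Module R A] [AddCommGroup B] [Module R B]
  [AddCommGroup C] [Module R C] [AddCommGroup A'] [Module R A'] [AddCommGroup B'] [Module R B']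
  [AddCommGroup C'] [Module R C']

lemma rTensor_lTensor_comm (f : A →ₗ[R] B) (g : A' →ₗ[R] B') (t : A ⊗[R] A') :
    f.rTensor B' (g.lTensor A t) = g.lTensor B (f.rTensor A' t) := by
  rw [← LinearMap.comp_apply, ← LinearMap.comp_apply, LinearMap.rTensor_comp_lTensor,
    LinearMap.lTensor_comp_rTensor]

/-- Balancing of `Tor₁`: if `Tor₁(C, B')` and the connecting map out of `Tor₁(C, C')` vanish, the
sequence `A → B → C` stays exact on the left after tensoring with `C'`. -/
lemma rTensor_injective_of_balanced {i : A →ₗ[R] B} {p : B →ₗ[R] C} {i' : A' →ₗ[R] B'}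
    {p' : B' →ₗ[R] C'} (hip : Function.Exact i p) (hp : Function.Surjective p)
    (hip' : Function.Exact i' p') (hp' : Function.Surjective p')
    (h₁ : Function.Injective (i.rTensor B')) (h₂ : Function.Injective (i'.lTensor C)) :
    Function.Injective (i.rTensor C') := by
  rw [injective_iff_map_eq_zero]
  intro x hx
  obtain ⟨y, rfl⟩ := LinearMap.lTensor_surjective A hp' x
  rw [rTensor_lTensor_comm] at hx
  obtain ⟨z, hz⟩ := (lTensor_exact B hip' hp' _).1 hx
  have hz0 : p.rTensor A' z = 0 := by
    apply h₂
    rw [← rTensor_lTensor_comm, hz, map_zero]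
    exact (rTensor_exact B' hip hp).apply_apply_eq_zero y
  obtain ⟨w, rfl⟩ := (rTensor_exact A' hip hp _).1 hz0
  rw [← rTensor_lTensor_comm] at hz
  rw [← h₁ hz]
  exact (lTensor_exact A hip' hp').apply_apply_eq_zero w

lemma exact_of_range_eq_ker {i : A →ₗ[R] B} {p : B →ₗ[R] C}
    (h : LinearMap.range i = LinearMap.ker p) : Function.Exact i p :=
  LinearMap.exact_iff.2 h.symm

/-- `Tor₁(M, I) = 0` for every injective module `I`, stated through short exact sequences ending
in `M`. -/
def TorInjectiveVanishes (M : Type u) [AddCommGroup M] [Module R M] : Prop :=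
  ∀ (I : Type u) [AddCommGroup I] [Module R I] [Module.Injective R I] (A B : Type u)
    [AddCommGroup A] [Module R A] [AddCommGroup B] [Module R B] (i : A →ₗ[R] B) (p : B →ₗ[R] M),
    Function.Injective i → Function.Surjective p → LinearMap.range i = LinearMap.ker p →
    Function.Injective (i.rTensor I)

lemma TorInjectiveVanishes.of_exact {M' M M'' : Type u} [AddCommGroup M'] [Module R M']
    [AddCommGroup M] [Module R M] [AddCommGroup M''] [Module R M''] {j : M' →ₗ[R] M}
    {q : M →ₗ[R] M''} (hj : Function.Injective j) (hq : Function.Surjective q)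
    (hjq : LinearMap.range j = LinearMap.ker q) (h' : TorInjectiveVanishes (R := R) M')
    (h'' : TorInjectiveVanishes (R := R) M'') : TorInjectiveVanishes (R := R) M := by
  intro I _ _ _ A B _ _ _ _ i p hi hp hip
  have hpi (a) : p (i a) = 0 := (exact_of_range_eq_ker hip).apply_apply_eq_zero a
  let N := LinearMap.ker (q ∘ₗ p)
  let i' : A →ₗ[R] N := i.codRestrict N fun a => by simp [N, hpi]
  obtain ⟨p', hp'⟩ := exists_comp_eq_of_injective hj (g := p ∘ₗ N.subtype) (by
    rw [hjq]
    rintro _ ⟨x, rfl⟩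
    exact x.2)
  have hp'' (x : N) : j (p' x) = p x := LinearMap.congr_fun hp' x
  have h1 : Function.Injective (i'.rTensor I) := by
    refine h' I A N i' p' (fun x y hxy => hi (congrArg Subtype.val hxy)) ?_ ?_
    · intro m
      obtain ⟨b, hb⟩ := hp (j m)
      refine ⟨⟨b, ?_⟩, hj ?_⟩
      · simpa [N, hb] using (exact_of_range_eq_ker hjq).apply_apply_eq_zero m
      · rw [hp'', hb]
    · ext x
      rw [LinearMap.mem_ker, ← map_eq_zero_iff j hj, hp'', ← LinearMap.mem_ker, ← hip]
      exact exists_congr fun a => Subtype.ext_iff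
  have h2 : Function.Injective (N.subtype.rTensor I) :=
    h'' I N B N.subtype (q ∘ₗ p) N.subtype_injective (hq.comp hp) (by simp [N])
  have : i = N.subtype ∘ₗ i' := rfl
  rw [this, LinearMap.rTensor_comp]
  exact h2.comp h1

/-- Over a Gorenstein hereditary ring, every injective module is a retract of the cokernel of an
injection between projective modules. -/
lemma IsGHereditaryRing.exists_retract_of_injective (h : IsGHereditaryRing R) (I : Type u)
    [AddCommGroup I] [Module R I] [Module.Injective R I] :
    ∃ (P : Type u) (_ : AddCommGroup P) (_ : Module R P) (Q : Type u) (_ : AddCommGroup Q)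
      (_ : Module R Q) (E : Type u) (_ : AddCommGroup E) (_ : Module R E) (u : P →ₗ[R] Q)
      (v : Q →ₗ[R] E) (ι : I →ₗ[R] E) (ρ : E →ₗ[R] I), Module.Projective R P ∧
      Module.Projective R Q ∧ Function.Injective u ∧ Function.Surjective v ∧
      LinearMap.range u = LinearMap.ker v ∧ ρ ∘ₗ ι = LinearMap.id := by
  obtain ⟨Q, _, _, G, π, hQ, hπ, hK⟩ := h.exists_surjective_ker_projective I
  let u : LinearMap.ker π →ₗ[R] Q := G.subtype ∘ₗ (LinearMap.ker π).subtype
  obtain ⟨ι, hι⟩ := exists_comp_eq_of_surjective hπ (g := (LinearMap.range u).mkQ ∘ₗ G.subtype) (by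
    intro x hx
    exact (Submodule.Quotient.mk_eq_zero _).2 ⟨⟨x, hx⟩, rfl⟩)
  have hι' (x) : ι (π x) = (LinearMap.range u).mkQ x := LinearMap.congr_fun hι x
  have hinj : Function.Injective ι := by
    rw [injective_iff_map_eq_zero]
    intro x hx
    obtain ⟨g, rfl⟩ := hπ x
    rw [hι', Submodule.mkQ_apply, Submodule.Quotient.mk_eq_zero] at hx
    obtain ⟨y, hy⟩ := hx
    rw [← show (y : G) = g from Subtype.ext hy]
    exact y.2
  obtain ⟨ρ, hρ⟩ := Module.Injective.extension_property R I _ _ ι hinj LinearMap.id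
  exact ⟨LinearMap.ker π, _, _, Q, _, _, Q ⧸ LinearMap.range u, _, _, u,
    (LinearMap.range u).mkQ, ι, ρ, hK, hQ, G.subtype_injective.comp (Submodule.subtype_injective _),
    Submodule.mkQ_surjective _, (Submodule.ker_mkQ _).symm, hρ⟩

/-- Over a Gorenstein hereditary ring, `Tor₁(M, I) = 0` for `M` a submodule of a flat module and
`I` injective. -/
lemma TorInjectiveVanishes.of_injective_of_flat (h : IsGHereditaryRing R) {M F : Type u}
    [AddCommGroup M] [Module R M] [AddCommGroup F] [Module R F] [Module.Flat R F] (m : M →ₗ[R] F)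
    (hm : Function.Injective m) : TorInjectiveVanishes (R := R) M := by
  intro I _ _ _ A B _ _ _ _ i p hi hp hip
  obtain ⟨P, _, _, Q, _, _, E, _, _, u, v, ι, ρ, _, _, hu, hv, huv, hρ⟩ :=
    h.exists_retract_of_injective I
  have h₁ : Function.Injective (u.lTensor M) := by
    have h₂ : Function.Injective (u.lTensor F ∘ₗ m.rTensor P) :=
      (Module.Flat.lTensor_preserves_injective_linearMap u hu).comp
        (Module.Flat.rTensor_preserves_injective_linearMap m hm)
    rw [LinearMap.lTensor_comp_rTensor, ← LinearMap.rTensor_comp_lTensor] at h₂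
    exact Function.Injective.of_comp h₂
  have h₃ : Function.Injective (i.rTensor E) :=
    rTensor_injective_of_balanced (exact_of_range_eq_ker hip) hp (exact_of_range_eq_ker huv) hv
      (Module.Flat.rTensor_preserves_injective_linearMap i hi) h₁
  have h₄ : Function.Injective (ι.lTensor A) := by
    refine Function.LeftInverse.injective (g := ρ.lTensor A) fun x => ?_
    rw [← LinearMap.comp_apply, ← LinearMap.lTensor_comp, hρ, LinearMap.lTensor_id,
      LinearMap.id_apply]
  have h₅ : Function.Injective (i.rTensor E ∘ₗ ι.lTensor A) := h₃.comp h₄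
  rw [LinearMap.rTensor_comp_lTensor, ← LinearMap.lTensor_comp_rTensor] at h₅
  exact Function.Injective.of_comp h₅

lemma EmbedsInProjective.torInjectiveVanishes (h : IsGHereditaryRing R) {M : Type u}
    [AddCommGroup M] [Module R M] (hM : EmbedsInProjective (R := R) M) :
    TorInjectiveVanishes (R := R) M := by
  obtain ⟨P, _, _, i, _, hi⟩ := hM
  exact .of_injective_of_flat h i hi

lemma exists_injective_linearMap_injective (X : Type u) [AddCommGroup X] [Module R X] :
    ∃ (E : Type u) (_ : AddCommGroup E) (_ : Module R E) (i : X →ₗ[R] E),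
      Module.Injective R E ∧ Function.Injective i := by
  let J := CategoryTheory.Injective.under (ModuleCat.of R X)
  let i : ModuleCat.of R X ⟶ J := CategoryTheory.Injective.ι _
  have : CategoryTheory.Injective (ModuleCat.of R J) :=
    inferInstanceAs (CategoryTheory.Injective J)
  exact ⟨J, _, _, i.hom, Module.injective_module_of_injective_object R J,
    (ModuleCat.mono_iff_injective i).1 inferInstance⟩

/-- The cokernel `F` of an injection between flat modules is flat as soon as `Tor₁(F, I) = 0` for
every injective module `I`. -/
lemma TorInjectiveVanishes.flat {K P F : Type u} [AddCommGroup K] [Module R K] [AddCommGroup P]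
    [Module R P] [AddCommGroup F] [Module R F] [Module.Flat R K] [Module.Flat R P]
    (hF : TorInjectiveVanishes (R := R) F) {i : K →ₗ[R] P} {p : P →ₗ[R] F}
    (hi : Function.Injective i) (hp : Function.Surjective p)
    (hip : LinearMap.range i = LinearMap.ker p) : Module.Flat R F := by
  have key (X : Type u) [AddCommGroup X] [Module R X] : Function.Injective (i.rTensor X) := by
    obtain ⟨E, _, _, ι, _, hι⟩ := exists_injective_linearMap_injective (R := R) X
    have : Function.Injective (i.rTensor E ∘ₗ ι.lTensor K) :=
      (hF E K P i p hi hp hip).comp (Module.Flat.lTensor_preserves_injective_linearMap ι hι)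
    rw [LinearMap.rTensor_comp_lTensor, ← LinearMap.lTensor_comp_rTensor] at this
    exact Function.Injective.of_comp this
  refine Module.Flat.iff_rTensor_injective'.2 fun J => ?_
  refine rTensor_injective_of_balanced (p := J.mkQ) (exact_of_range_eq_ker (by simp))
    J.mkQ_surjective (exact_of_range_eq_ker hip) hp
    (Module.Flat.rTensor_preserves_injective_linearMap _ J.subtype_injective) ?_
  exact (LinearMap.lTensor_inj_iff_rTensor_inj _ _).2 (key _)

/-- The kernel of a surjection between flat modules is flat. -/
lemma flat_of_exact_of_flat {K P F : Type u} [AddCommGroup K] [Module R K] [AddCommGroup P]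
    [Module R P] [AddCommGroup F] [Module R F] [Module.Flat R P] [Module.Flat R F]
    {i : K →ₗ[R] P} {p : P →ₗ[R] F} (hi : Function.Injective i) (hp : Function.Surjective p)
    (hip : LinearMap.range i = LinearMap.ker p) : Module.Flat R K := by
  refine Module.Flat.iff_rTensor_injective'.2 fun J => ?_
  have h₁ : Function.Injective (i.lTensor J) :=
    LinearMap.lTensor_injective_of_exact_of_flat p hp i hi (exact_of_range_eq_ker hip) J
  have h₂ : Function.Injective (J.subtype.rTensor P ∘ₗ i.lTensor J) :=
    (Module.Flat.rTensor_preserves_injective_linearMap _ J.subtype_injective).comp h₁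
  rw [LinearMap.rTensor_comp_lTensor, ← LinearMap.lTensor_comp_rTensor] at h₂
  exact Function.Injective.of_comp h₂

end Tor

section StronglyGorenstein

/-- Tensoring with an injective module `I` preserves exactness of `X → Y → Z` as soon as
`Tor₁(M, I) = 0` for the cokernel `M` of `Y → Z`. -/
lemma TorInjectiveVanishes.range_rTensor_eq_ker {X Y Z M : Type u} [AddCommGroup X] [Module R X]
    [AddCommGroup Y] [Module R Y] [AddCommGroup Z] [Module R Z] [AddCommGroup M] [Module R M]
    (hM : TorInjectiveVanishes (R := R) M) {f : X →ₗ[R] Y} {g : Y →ₗ[R] Z} {q : Z →ₗ[R] M}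
    (hfg : LinearMap.range f = LinearMap.ker g) (hq : Function.Surjective q)
    (hgq : LinearMap.range g = LinearMap.ker q) (I : Type u) [AddCommGroup I] [Module R I]
    [Module.Injective R I] :
    LinearMap.range (f.rTensor I) = LinearMap.ker (g.rTensor I) := by
  have h₁ : Function.Injective ((LinearMap.range g).subtype.rTensor I) :=
    hM I _ _ _ q (Submodule.subtype_injective _) hq (by rw [Submodule.range_subtype, hgq])
  have h₂ : Function.Exact (f.rTensor I) (g.rangeRestrict.rTensor I) :=
    rTensor_exact I (exact_of_range_eq_ker (by rw [hfg, LinearMap.ker_rangeRestrict]))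
      g.surjective_rangeRestrict
  have h₃ : g.rTensor I = (LinearMap.range g).subtype.rTensor I ∘ₗ g.rangeRestrict.rTensor I := by
    rw [← LinearMap.rTensor_comp]
    rfl
  rw [h₃, LinearMap.ker_comp_of_ker_eq_bot _ (LinearMap.ker_eq_bot.2 h₁), LinearMap.exact_iff.1 h₂]

lemma IsGorensteinProjective.isGorensteinFlat (h : IsGHereditaryRing R) {M : Type u}
    [AddCommGroup M] [Module R M] (hM : IsGorensteinProjective R M) : IsGorensteinFlat R M := by
  obtain ⟨P, i1, i2, d, hP, hd, he, -⟩ := hM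
  refine ⟨P, i1, i2, d, fun i => inferInstance, hd, he, fun I _ _ _ i => ?_⟩
  have hT : TorInjectiveVanishes (R := R) (LinearMap.range (d (i + 1 + 1))) :=
    (EmbedsInProjective.submodule _).torInjectiveVanishes h
  exact hT.range_rTensor_eq_ker (hd i) (d (i + 1 + 1)).surjective_rangeRestrict
    (by rw [hd, LinearMap.ker_rangeRestrict]) I

lemma IsGorensteinFlat.torInjectiveVanishes (h : IsGHereditaryRing R) {M : Type u}
    [AddCommGroup M] [Module R M] (hM : IsGorensteinFlat R M) :
    TorInjectiveVanishes (R := R) M := by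
  obtain ⟨F, i1, i2, d, hF, -, ⟨e⟩, -⟩ := hM
  exact .of_injective_of_flat h ((LinearMap.range (d 0)).subtype ∘ₗ e.toLinearMap)
    ((Submodule.subtype_injective _).comp e.injective)

/-- A module `M` with `Tor₁(M, I) = 0` for all injective `I` is strongly Gorenstein flat as soon as it
is the quotient of a strongly Gorenstein projective module by a projective submodule. -/
lemma TorInjectiveVanishes.isStronglyGorensteinFlat
    {M G : Type u} [AddCommGroup M] [Module R M] [AddCommGroup G] [Module R G]
    (hM : TorInjectiveVanishes (R := R) M) (hG : IsStronglyGorensteinProjective R G)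
    (π : G →ₗ[R] M) (hπ : Function.Surjective π) (hK : Module.Projective R (LinearMap.ker π)) :
    IsStronglyGorensteinFlat R M := by
  obtain ⟨P, _, _, f, hP, hf, ⟨e⟩, -⟩ := hG
  let ν : LinearMap.ker π →ₗ[R] P :=
    (LinearMap.range f).subtype ∘ₗ e.toLinearMap ∘ₗ (LinearMap.ker π).subtype
  have hν : Function.Injective ν :=
    (Submodule.subtype_injective _).comp (e.injective.comp (Submodule.subtype_injective _))
  have hff (x) : f (f x) = 0 := (exact_of_range_eq_ker hf).apply_apply_eq_zero x
  have hfν (x) : f (ν x) = 0 := by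
    change ν x ∈ LinearMap.ker f
    rw [← hf]
    exact (e x).2
  obtain ⟨s, hs⟩ := Module.projective_lifting_property f.rangeRestrict
    (e.toLinearMap ∘ₗ (LinearMap.ker π).subtype) f.surjective_rangeRestrict
  have hs' (x) : f (s x) = ν x := congrArg Subtype.val (LinearMap.congr_fun hs x)
  let t := ν.coprod s
  have ht' (k l) : t (k, l) = ν k + s l := by simp [t]
  have hft (k l) : f (t (k, l)) = ν l := by rw [ht', map_add, hfν, hs', zero_add]
  have ht : Function.Injective t := by
    rw [injective_iff_map_eq_zero]
    rintro ⟨k, l⟩ hkl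
    have hl : l = 0 := hν (by rw [← hft k, hkl, map_zero, map_zero])
    subst hl
    have hk : k = 0 := hν (by simpa [ht'] using hkl)
    rw [hk, Prod.mk_zero_zero]
  let K := LinearMap.range t
  let fb : P ⧸ K →ₗ[R] P ⧸ K := K.mapQ K f (by
    rintro _ ⟨⟨k, l⟩, rfl⟩
    exact ⟨(l, 0), by rw [hft, ht', map_zero, add_zero]⟩)
  have hfb (x) : fb (K.mkQ x) = K.mkQ (f x) := rfl
  have hexact : LinearMap.range fb = LinearMap.ker fb := by
    apply le_antisymm
    · rintro _ ⟨y, rfl⟩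
      obtain ⟨x, rfl⟩ := K.mkQ_surjective y
      rw [LinearMap.mem_ker, hfb, hfb, hff, map_zero]
    · intro y hy
      obtain ⟨x, rfl⟩ := K.mkQ_surjective y
      rw [LinearMap.mem_ker, hfb, Submodule.mkQ_apply, Submodule.Quotient.mk_eq_zero] at hy
      obtain ⟨⟨k, l⟩, hkl⟩ := hy
      have hl : l = 0 := hν (by rw [← hft k, hkl, hff, map_zero])
      have hx : x - s k ∈ LinearMap.range f := by
        rw [hf, LinearMap.mem_ker, map_sub, ← hkl, hl, ht', map_zero, add_zero, hs', sub_self]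
      obtain ⟨z, hz⟩ := hx
      refine ⟨K.mkQ z, ?_⟩
      rw [hfb, hz, map_sub, sub_eq_self, Submodule.mkQ_apply, Submodule.Quotient.mk_eq_zero]
      exact ⟨(0, k), by rw [ht', map_zero, zero_add]⟩
  obtain ⟨ι, hι⟩ := exists_comp_eq_of_surjective hπ
    (g := K.mkQ ∘ₗ (LinearMap.range f).subtype ∘ₗ e.toLinearMap) (by
      intro x hx
      exact (Submodule.Quotient.mk_eq_zero _).2
        ⟨(⟨x, hx⟩, 0), by rw [ht', map_zero, add_zero]; rfl⟩)
  have hι' (x) : ι (π x) = K.mkQ (e x) := LinearMap.congr_fun hι x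
  have hιinj : Function.Injective ι := by
    rw [injective_iff_map_eq_zero]
    intro m hm
    obtain ⟨x, rfl⟩ := hπ m
    rw [hι', Submodule.mkQ_apply, Submodule.Quotient.mk_eq_zero] at hm
    obtain ⟨⟨k, l⟩, hkl⟩ := hm
    have hex : f (e x) = 0 := by
      change (e x : P) ∈ LinearMap.ker f
      rw [← hf]
      exact (e x).2
    have hl : l = 0 := hν (by rw [← hft k, hkl, hex, map_zero])
    rw [hl, ht', map_zero, add_zero] at hkl
    have hkx : (k : G) = x := e.injective (Subtype.ext hkl)
    rw [← hkx]
    exact k.2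
  have hιrange : LinearMap.range ι = LinearMap.range fb := by
    apply le_antisymm
    · rintro _ ⟨m, rfl⟩
      obtain ⟨x, rfl⟩ := hπ m
      obtain ⟨y, hy⟩ := (e x).2
      exact ⟨K.mkQ y, by rw [hι', hfb, hy]⟩
    · rintro _ ⟨y, rfl⟩
      obtain ⟨x, rfl⟩ := K.mkQ_surjective y
      exact ⟨π (e.symm ⟨f x, x, rfl⟩), by rw [hι', hfb, e.apply_symm_apply]⟩
  obtain ⟨ρ, hρ⟩ := exists_comp_eq_of_injective hιinj hιrange.ge
  have hρsurj : Function.Surjective ρ := by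
    intro m
    obtain ⟨y, hy⟩ : ι m ∈ LinearMap.range fb := hιrange ▸ LinearMap.mem_range_self ι m
    exact ⟨y, hιinj (by rw [← hy, ← hρ]; rfl)⟩
  have hρker : LinearMap.ker ρ = LinearMap.ker fb := by
    rw [← hρ, LinearMap.ker_comp_of_ker_eq_bot _ (LinearMap.ker_eq_bot.2 hιinj)]
  have hTF : TorInjectiveVanishes (R := R) (P ⧸ K) :=
    .of_exact hιinj hρsurj (by rw [hιrange, hexact, hρker]) hM hM
  exact ⟨P ⧸ K, _, _, fb, hTF.flat ht K.mkQ_surjective (K.ker_mkQ).symm, hexact,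
    ⟨(LinearEquiv.ofInjective ι hιinj).trans (LinearEquiv.ofEq _ _ hιrange)⟩,
    fun I _ _ _ => hM.range_rTensor_eq_ker hexact hρsurj (hexact.trans hρker.symm) I⟩

end StronglyGorenstein

section Telescope

open DirectSum

section Shift

variable {ι : Type*} [DecidableEq ι] {M N : ι → Type*} [∀ i, AddCommGroup (M i)]
  [∀ i, Module R (M i)] [∀ i, AddCommGroup (N i)] [∀ i, Module R (N i)]

/-- The map of direct sums induced by maps `g i : M i → N (s i)`. -/
def directSumShift (s : ι → ι) (g : ∀ i, M i →ₗ[R] N (s i)) : (⨁ i, M i) →ₗ[R] ⨁ i, N i :=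
  toModule R ι _ fun i => lof R ι N (s i) ∘ₗ g i

lemma directSumShift_lof (s : ι → ι) (g : ∀ i, M i →ₗ[R] N (s i)) (i : ι) (x : M i) :
    directSumShift s g (lof R ι M i x) = lof R ι N (s i) (g i x) := by
  simp [directSumShift, toModule_lof]

lemma directSumShift_apply {s : ι → ι} (hs : Function.Injective s) (g : ∀ i, M i →ₗ[R] N (s i))
    (x : ⨁ i, M i) (k : ι) : directSumShift s g x (s k) = g k (x k) := by
  induction x using DirectSum.induction_on with
  | zero => simp
  | of i y =>
    change directSumShift s g (lof R ι M i y) (s k) = g k (lof R ι M i y k)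
    rw [directSumShift_lof]
    by_cases hik : i = k
    · subst hik
      rw [lof_apply, lof_apply]
    · rw [lof_eq_of, lof_eq_of, of_eq_of_ne _ _ _ (Ne.symm hik),
        of_eq_of_ne _ _ _ fun h => hik (hs h).symm, map_zero]
  | add x y hx hy => rw [map_add, DirectSum.add_apply, hx, hy, DirectSum.add_apply, map_add]

lemma directSumShift_apply_of_notMem {s : ι → ι} (g : ∀ i, M i →ₗ[R] N (s i)) (x : ⨁ i, M i)
    {k : ι} (hk : ∀ i, k ≠ s i) : directSumShift s g x k = 0 := by
  induction x using DirectSum.induction_on with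
  | zero => simp
  | of i y =>
    change directSumShift s g (lof R ι M i y) k = 0
    rw [directSumShift_lof, lof_eq_of, of_eq_of_ne _ _ _ (hk i)]
  | add x y hx hy => rw [map_add, DirectSum.add_apply, hx, hy, add_zero]

end Shift

/-- If `0 → B → B → C → 0` is exact with first map `Φ`, the map `1 - Φ` factors through a
projective module `Q` as `β ∘ α`, and `α` extends along `Φ`, then `C` is projective. -/
lemma projective_of_factorization {B C Q : Type*} [AddCommGroup B] [Module R B] [AddCommGroup C]
    [Module R C] [AddCommGroup Q] [Module R Q] [Module.Projective R Q] {Φ : B →ₗ[R] B}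
    {ψ : B →ₗ[R] C} {α ε : B →ₗ[R] Q} {β : Q →ₗ[R] B} (hψ : Function.Surjective ψ)
    (hΦψ : LinearMap.range Φ = LinearMap.ker ψ) (hαβ : ∀ x, β (α x) = x - Φ x)
    (hε : ε ∘ₗ Φ = α) : Module.Projective R C := by
  have hψΦ (x) : ψ (Φ x) = 0 := (exact_of_range_eq_ker hΦψ).apply_apply_eq_zero x
  have hε' (x) : ε (Φ x) = α x := LinearMap.congr_fun hε x
  obtain ⟨σ, hσ⟩ := exists_comp_eq_of_surjective hψ
    (g := LinearMap.id - Φ ∘ₗ (LinearMap.id + β ∘ₗ ε)) (by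
      rw [← hΦψ]
      rintro _ ⟨x, rfl⟩
      simp [hε', hαβ])
  have hσ' (x) : σ (ψ x) = x - Φ (x + β (ε x)) := LinearMap.congr_fun hσ x
  refine Module.Projective.of_split (α ∘ₗ σ) (ψ ∘ₗ β) ?_
  ext c
  obtain ⟨x, rfl⟩ := hψ c
  simp [hαβ, hψΦ, hσ']

/-- Over a Gorenstein hereditary ring, the union of an increasing sequence of submodules of a
projective module is projective, provided each inclusion factors through a projective module. -/
lemma projective_iSup_of_factorization (h : IsGHereditaryRing R) {M : Type u} [AddCommGroup M]
    [Module R M] (hM : EmbedsInProjective (R := R) M) {N : ℕ → Submodule R M} (hN : Monotone N)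
    {Q : ℕ → Type u} [∀ n, AddCommGroup (Q n)] [∀ n, Module R (Q n)]
    [∀ n, Module.Projective R (Q n)] (a : ∀ n, N n →ₗ[R] Q n) (b : ∀ n, Q n →ₗ[R] N (n + 1))
    (hab : ∀ n x, (b n (a n x) : M) = x) : Module.Projective R (⨆ n, N n : Submodule R M) := by
  let C : Submodule R M := ⨆ n, N n
  let incl (m n : ℕ) (hmn : m ≤ n) : N m →ₗ[R] N n := Submodule.inclusion (hN hmn)
  let T : (⨁ n, N n) →ₗ[R] ⨁ n, N n :=
    directSumShift (fun n => n + 1) fun n => incl n (n + 1) n.le_succ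
  let Φ : (⨁ n, N n) →ₗ[R] ⨁ n, N n := LinearMap.id - T
  let ψ : (⨁ n, N n) →ₗ[R] C := toModule R ℕ _ fun n => Submodule.inclusion (le_iSup N n)
  have hψ (n) (x : N n) : (ψ (lof R ℕ (fun n => N n) n x) : M) = x := by simp [ψ, toModule_lof]
  have hΦ (n) (x : N n) : Φ (lof R ℕ (fun n => N n) n x) =
      lof R ℕ (fun n => N n) n x -
        lof R ℕ (fun n => N n) (n + 1) (incl n (n + 1) n.le_succ x) := by
    simp [Φ, T, directSumShift_lof]
  have hΦψ : LinearMap.range Φ ≤ LinearMap.ker ψ := by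
    rintro _ ⟨v, rfl⟩
    have : ψ ∘ₗ Φ = 0 := by
      ext n x
      simp only [LinearMap.comp_apply, hΦ, map_sub]
      simp [hψ, incl]
    exact LinearMap.congr_fun this v
  have hshift (m n : ℕ) (hmn : m ≤ n) (x : N m) : lof R ℕ (fun n => N n) m x -
      lof R ℕ (fun n => N n) n (incl m n hmn x) ∈ LinearMap.range Φ := by
    induction n, hmn using Nat.le_induction with
    | base =>
      have : incl m m le_rfl x = x := rfl
      rw [this, sub_self]
      exact zero_mem _
    | succ n hmn ih =>
      have h2 : Φ (lof R ℕ (fun n => N n) n (incl m n hmn x)) ∈ LinearMap.range Φ := ⟨_, rfl⟩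
      rw [hΦ] at h2
      have := add_mem ih h2
      rwa [sub_add_sub_cancel] at this
  have hrep (v : ⨁ n, N n) :
      ∃ (n : ℕ) (x : N n), v - lof R ℕ (fun n => N n) n x ∈ LinearMap.range Φ := by
    induction v using DirectSum.induction_on with
    | zero => exact ⟨0, 0, by simp⟩
    | of i y => exact ⟨i, y, by simp [lof_eq_of]⟩
    | add v w hv hw =>
      obtain ⟨m, x, hx⟩ := hv
      obtain ⟨n, y, hy⟩ := hw
      refine ⟨max m n, incl m _ (le_max_left m n) x + incl n _ (le_max_right m n) y, ?_⟩
      have := add_mem (add_mem hx (hshift m _ (le_max_left m n) x))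
        (add_mem hy (hshift n _ (le_max_right m n) y))
      rw [map_add]
      convert this using 1
      abel
  have hexact : LinearMap.range Φ = LinearMap.ker ψ := by
    refine le_antisymm hΦψ fun v hv => ?_
    obtain ⟨n, x, hx⟩ := hrep v
    have hx0 : (x : M) = 0 := by
      have := hΦψ hx
      rw [LinearMap.mem_ker, map_sub, LinearMap.mem_ker.1 hv, zero_sub, neg_eq_zero] at this
      rw [← hψ, this, ZeroMemClass.coe_zero]
    rw [show x = 0 from Subtype.ext hx0, map_zero, sub_zero] at hx
    exact hx
  have hinj : Function.Injective Φ := by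
    rw [injective_iff_map_eq_zero]
    intro v hv
    have hv' : v = T v := sub_eq_zero.1 hv
    ext n
    induction n with
    | zero =>
      rw [hv', directSumShift_apply_of_notMem _ _ fun i => (Nat.succ_ne_zero i).symm]
      rfl
    | succ n ih =>
      have ih' : v n = 0 := Subtype.ext ih
      rw [hv', directSumShift_apply (s := fun n => n + 1) (add_left_injective 1), ih', map_zero]
      rfl
  have hsurj : Function.Surjective ψ := by
    rintro ⟨c, hc⟩
    obtain ⟨n, hn⟩ := (Submodule.mem_iSup_of_directed N hN.directed_le).1 hc
    exact ⟨lof R ℕ (fun n => N n) n ⟨c, hn⟩, Subtype.ext (hψ n _)⟩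
  have hC : IsGorensteinProjective R C :=
    (hM.of_injective C.subtype C.subtype_injective).isGorensteinProjective h
  obtain ⟨ε, hε⟩ := hC.exists_extension (Q := ⨁ n, Q n) hinj hsurj hexact (DirectSum.lmap a)
  refine projective_of_factorization (β := directSumShift (fun n => n + 1) b) hsurj hexact ?_ hε
  intro v
  have : directSumShift (fun n => n + 1) b ∘ₗ DirectSum.lmap a = T := by
    ext n x : 2
    simp only [LinearMap.comp_apply, DirectSum.lmap_lof, T, directSumShift_lof]
    congr 1
    exact Subtype.ext (hab n x)
  rw [← LinearMap.comp_apply, this]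
  simp [Φ]

end Telescope

section FlatPeriodic

variable {X : Type u} {f : (X →₀ R) →ₗ[R] (X →₀ R)}

lemma Submodule.FG.exists_finset_le_map_supported {N : Submodule R (X →₀ R)} (hN : N.FG)
    (hle : N ≤ LinearMap.range f) :
    ∃ T : Finset X, N ≤ (Finsupp.supported R R (T : Set X)).map f := by
  classical
  obtain ⟨S, rfl⟩ := hN
  choose y hy using fun m : S => hle (Submodule.subset_span m.2)
  refine ⟨S.attach.biUnion fun m => (y m).support, Submodule.span_le.2 fun v hv => ?_⟩
  refine ⟨y ⟨v, hv⟩, ?_, hy _⟩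
  rw [SetLike.mem_coe, Finsupp.mem_supported]
  exact_mod_cast Finset.subset_biUnion_of_mem (fun m : S => (y m).support)
    (Finset.mem_attach S ⟨v, hv⟩)

/-- The kernel of an endomorphism restricted to finitely many basis vectors is finitely generated. -/
lemma fg_ker_inf_supported (h : IsGHereditaryRing R) (f : (X →₀ R) →ₗ[R] (X →₀ R)) (T : Finset X) :
    (LinearMap.ker f ⊓ Finsupp.supported R R (T : Set X)).FG := by
  have : Module.Finite R ((Finsupp.supported R R (T : Set X)).map f) := inferInstance
  have : Module.FinitePresentation R ((Finsupp.supported R R (T : Set X)).map f) :=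
    (EmbedsInProjective.submodule _).finitePresentation h
  have hfg := Module.FinitePresentation.fg_ker (R := R) (M := Finsupp.supported R R (T : Set X))
    (N := (Finsupp.supported R R (T : Set X)).map f) (f.submoduleMap _) (f.submoduleMap_surjective (Finsupp.supported R R (T : Set X)))
  have hker : LinearMap.ker f ⊓ Finsupp.supported R R (T : Set X) =
      (LinearMap.ker (f.submoduleMap (Finsupp.supported R R (T : Set X)))).map
        (Submodule.subtype _) := by
    ext x
    constructor
    · rintro ⟨hx, hxT⟩
      exact ⟨⟨x, hxT⟩, Subtype.ext hx, rfl⟩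
    · rintro ⟨y, hy, rfl⟩
      exact ⟨congrArg Subtype.val hy, y.2⟩
  rw [hker]
  exact hfg.map _

/-- If the range of an endomorphism is flat, the inclusion of the image of the span of finitely
many basis vectors factors through a finite free module. -/
lemma exists_factorization_map_supported (h : IsGHereditaryRing R)
    [Module.Flat R (LinearMap.range f)] (T : Finset X) :
    ∃ (B : Finset X) (k : ℕ)
      (a : (Finsupp.supported R R (T : Set X)).map f →ₗ[R] (Fin k →₀ R))
      (b : (Fin k →₀ R) →ₗ[R] (X →₀ R)),
        LinearMap.range b ≤ (Finsupp.supported R R (B : Set X)).map f ∧ ∀ x, b (a x) = x := by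
  have : Module.Finite R ((Finsupp.supported R R (T : Set X)).map f) := inferInstance
  have : Module.FinitePresentation R ((Finsupp.supported R R (T : Set X)).map f) :=
    (EmbedsInProjective.submodule _).finitePresentation h
  obtain ⟨k, a, b, hab⟩ := Module.Flat.exists_factorization_of_finitePresentation (R := R)
    (P := (Finsupp.supported R R (T : Set X)).map f) (M := LinearMap.range f)
    (Submodule.inclusion
      (LinearMap.map_le_range (f := f) (p := Finsupp.supported R R (T : Set X))))
  have hc : (LinearMap.range ((LinearMap.range f).subtype ∘ₗ b)).FG :=
    Module.Finite.iff_fg.1 inferInstance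
  obtain ⟨B, hB⟩ := hc.exists_finset_le_map_supported (f := f) (by
    rintro _ ⟨x, rfl⟩
    exact (b x).2)
  exact ⟨B, k, a, (LinearMap.range f).subtype ∘ₗ b, hB,
    fun x => (congrArg Subtype.val (LinearMap.congr_fun hab x)).symm⟩

/-- One step of the construction of a countable set of basis vectors closed under `f`. -/
lemma exists_finset_closure (h : IsGHereditaryRing R) (hf : LinearMap.range f = LinearMap.ker f)
    [Module.Flat R (LinearMap.range f)] (T : Finset X) :
    ∃ B : Finset X, T ⊆ B ∧
      (Finsupp.supported R R (T : Set X)).map f ≤ Finsupp.supported R R (B : Set X) ∧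
      LinearMap.ker f ⊓ Finsupp.supported R R (T : Set X) ≤
        (Finsupp.supported R R (B : Set X)).map f ∧
      ∃ (k : ℕ) (a : (Finsupp.supported R R (T : Set X)).map f →ₗ[R] (Fin k →₀ R))
        (b : (Fin k →₀ R) →ₗ[R] (Finsupp.supported R R (B : Set X)).map f),
        ∀ x, (b (a x) : X →₀ R) = x := by
  classical
  have hPT : (Finsupp.supported R R (T : Set X)).FG := Module.Finite.iff_fg.1 inferInstance
  obtain ⟨B₁, hB₁⟩ := (hPT.map f).exists_finset_le_supported
  obtain ⟨B₂, hB₂⟩ := (fg_ker_inf_supported h f T).exists_finset_le_map_supported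
    (inf_le_left.trans hf.ge)
  obtain ⟨B₃, k, a, b, hB₃, hab⟩ := exists_factorization_map_supported (f := f) h T
  have mono {B B' : Finset X} (hBB : B ⊆ B') :
      Finsupp.supported R R (B : Set X) ≤ Finsupp.supported R R (B' : Set X) :=
    Finsupp.supported_mono (by exact_mod_cast hBB)
  have h₁ : B₁ ⊆ T ∪ B₁ ∪ B₂ ∪ B₃ := by grind
  have h₂ : B₂ ⊆ T ∪ B₁ ∪ B₂ ∪ B₃ := by grind
  have h₃ : B₃ ⊆ T ∪ B₁ ∪ B₂ ∪ B₃ := by grind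
  have h₀ : T ⊆ T ∪ B₁ ∪ B₂ ∪ B₃ := by grind
  generalize T ∪ B₁ ∪ B₂ ∪ B₃ = B at h₀ h₁ h₂ h₃
  exact ⟨B, h₀, hB₁.trans (mono h₁), hB₂.trans (Submodule.map_mono (mono h₂)), k, a,
    b.codRestrict _ fun x => Submodule.map_mono (mono h₃) (hB₃ (LinearMap.mem_range_self b x)),
    hab⟩

/-- Any basis vector lies in a free summand spanned by basis vectors on which the endomorphism `f`
is split. -/
lemma exists_split_summand (h : IsGHereditaryRing R) (hf : LinearMap.range f = LinearMap.ker f)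
    [Module.Flat R (LinearMap.range f)] (x₀ : X) :
    ∃ (D : Submodule R (X →₀ R)) (S : Set X), x₀ ∈ S ∧ Disjoint D (LinearMap.ker f) ∧
      Finsupp.supported R R S = D ⊔ D.map f := by
  choose B hTB hmap hker k a b hab using exists_finset_closure h hf
  let T : ℕ → Finset X := fun n => B^[n] {x₀}
  have hT (n) : T (n + 1) = B (T n) := Function.iterate_succ_apply' B n _
  have hTmono : Monotone T := monotone_nat_of_le_succ fun n => by
    rw [hT]
    exact hTB _
  let PT : ℕ → Submodule R (X →₀ R) := fun n => Finsupp.supported R R (T n : Set X)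
  have hPT : Monotone PT := fun m n hmn => Finsupp.supported_mono (by exact_mod_cast hTmono hmn)
  let S : Set X := ⋃ n, (T n : Set X)
  have hS : Finsupp.supported R R S = ⨆ n, PT n := Finsupp.supported_iUnion _
  let N : ℕ → Submodule R (X →₀ R) := fun n => (PT n).map f
  have hmapS : (Finsupp.supported R R S).map f = ⨆ n, N n := by rw [hS, Submodule.map_iSup]
  have hNS : ⨆ n, N n ≤ Finsupp.supported R R S := by
    rw [hS]
    refine iSup_le fun n => le_trans ?_ (le_iSup PT (n + 1))
    simp only [N, PT, hT]
    exact hmap _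
  have hkerS (x) (hx : f x = 0) (hxS : x ∈ Finsupp.supported R R S) : x ∈ ⨆ n, N n := by
    rw [hS, Submodule.mem_iSup_of_directed _ hPT.directed_le] at hxS
    obtain ⟨n, hn⟩ := hxS
    refine le_iSup N (n + 1) ?_
    simp only [N, PT, hT]
    exact hker _ ⟨hx, hn⟩
  have hff (x) : f (f x) = 0 := (exact_of_range_eq_ker hf).apply_apply_eq_zero x
  have hfN (x) (hx : x ∈ ⨆ n, N n) : f x = 0 := by
    rw [← hmapS] at hx
    obtain ⟨y, -, rfl⟩ := hx
    exact hff y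
  have hproj : Module.Projective R (⨆ n, N n : Submodule R (X →₀ R)) :=
    projective_iSup_of_factorization h (.of_projective _) (fun m n hmn => Submodule.map_mono (hPT hmn))
      (Q := fun n => ULift.{u} (Fin (k (T n)) →₀ R))
      (fun n => ULift.moduleEquiv.symm.toLinearMap ∘ₗ a (T n))
      (fun n => (Submodule.inclusion (by simp only [N, PT, hT]; exact le_rfl)) ∘ₗ b (T n) ∘ₗ
        ULift.moduleEquiv.toLinearMap) (fun n x => hab (T n) x)
  let fS : Finsupp.supported R R S →ₗ[R] (⨆ n, N n : Submodule R (X →₀ R)) :=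
    (f ∘ₗ Submodule.subtype _).codRestrict _ fun x => hmapS ▸ ⟨x, x.2, rfl⟩
  obtain ⟨σ, hσ⟩ := Module.projective_lifting_property fS LinearMap.id (by
    rintro ⟨y, hy⟩
    rw [← hmapS] at hy
    obtain ⟨x, hx, rfl⟩ := hy
    exact ⟨⟨x, hx⟩, rfl⟩)
  have hσ' (c) : f (σ c) = c := congrArg Subtype.val (LinearMap.congr_fun hσ c)
  let τ := (Finsupp.supported R R S).subtype ∘ₗ σ
  refine ⟨LinearMap.range τ, S, Set.mem_iUnion.2 ⟨0, by simp [T]⟩, ?_, le_antisymm ?_ ?_⟩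
  · rw [Submodule.disjoint_def]
    rintro _ ⟨c, rfl⟩ hc
    have : c = 0 := Subtype.ext ((hσ' c).symm.trans hc)
    rw [this, map_zero]
  · intro x hx
    have hfx : f x ∈ ⨆ n, N n := hmapS ▸ ⟨x, hx, rfl⟩
    let c : (⨆ n, N n : Submodule R (X →₀ R)) := ⟨f x, hfx⟩
    have hy : x - τ c ∈ ⨆ n, N n := by
      refine hkerS _ ?_ (sub_mem hx (σ c).2)
      rw [map_sub]
      exact sub_eq_zero.2 (hσ' c).symm
    refine Submodule.mem_sup.2 ⟨τ c, ⟨c, rfl⟩, x - τ c, ⟨τ ⟨_, hy⟩, ⟨_, rfl⟩, hσ' _⟩, by abel⟩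
  · refine sup_le ?_ ?_
    · rintro _ ⟨c, rfl⟩
      exact (σ c).2
    · rintro _ ⟨_, ⟨c, rfl⟩, rfl⟩
      change f (σ c) ∈ _
      rw [hσ']
      exact hNS c.2

end FlatPeriodic

section FlatPeriodicProjective

variable {X : Type u} {f : (X →₀ R) →ₗ[R] (X →₀ R)}

/-- `D` is a complement of the kernel of `f` in a free summand spanned by basis vectors. -/
def IsSplitSubmodule (f : (X →₀ R) →ₗ[R] (X →₀ R)) (D : Submodule R (X →₀ R)) (S : Set X) : Prop :=
  Disjoint D (LinearMap.ker f) ∧ Finsupp.supported R R S = D ⊔ D.map f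

lemma IsSplitSubmodule.mem_map {D : Submodule R (X →₀ R)} {S : Set X}
    (hD : IsSplitSubmodule f D S) (hff : ∀ x, f (f x) = 0) {x : X →₀ R}
    (hx : f x ∈ Finsupp.supported R R S) : f x ∈ D.map f := by
  rw [hD.2] at hx
  obtain ⟨d, hd, _, ⟨d', hd', rfl⟩, hdd⟩ := Submodule.mem_sup.1 hx
  have h0 : d = 0 := by
    refine Submodule.disjoint_def.1 hD.1 d hd ?_
    rw [LinearMap.mem_ker, ← hff x, ← hdd, map_add, hff, add_zero]
  rw [← hdd, h0, zero_add]
  exact ⟨d', hd', rfl⟩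

lemma IsSplitSubmodule.projective_map {D : Submodule R (X →₀ R)} {S : Set X}
    (hD : IsSplitSubmodule f D S) (hff : ∀ x, f (f x) = 0) : Module.Projective R (D.map f) := by
  have hDS : D ≤ Finsupp.supported R R S := by rw [hD.2]; exact le_sup_left
  have hmap (x : Finsupp.supported R R S) : f x ∈ D.map f := by
    obtain ⟨d, hd, _, ⟨d', hd', rfl⟩, hdd⟩ := Submodule.mem_sup.1 (hD.2.le x.2)
    rw [← hdd, map_add, hff, add_zero]
    exact ⟨d, hd, rfl⟩
  have hbij : Function.Bijective (f.submoduleMap D) := by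
    refine ⟨(injective_iff_map_eq_zero _).2 fun x hx => Subtype.ext ?_,
      f.submoduleMap_surjective D⟩
    exact Submodule.disjoint_def.1 hD.1 x x.2 (congrArg Subtype.val hx)
  let e : D ≃ₗ[R] D.map f := LinearEquiv.ofBijective (f.submoduleMap D) hbij
  refine Module.Projective.of_split (M := Finsupp.supported R R S)
    (Submodule.inclusion hDS ∘ₗ e.symm.toLinearMap)
    ((f ∘ₗ Submodule.subtype _).codRestrict _ hmap) ?_
  ext1 x
  exact (e.apply_symm_apply x)

lemma IsSplitSubmodule.exists_lt (h : IsGHereditaryRing R)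
    (hf : LinearMap.range f = LinearMap.ker f) [Module.Flat R (LinearMap.range f)]
    {D : Submodule R (X →₀ R)} {S : Set X} (hD : IsSplitSubmodule f D S)
    (hS : Finsupp.supported R R S ≠ ⊤) :
    ∃ (D' : Submodule R (X →₀ R)) (S' : Set X), IsSplitSubmodule f D' S' ∧ D < D' := by
  have hff (x) : f (f x) = 0 := (exact_of_range_eq_ker hf).apply_apply_eq_zero x
  have := hD.projective_map hff
  let res : (X →₀ R) →ₗ[R] ((Sᶜ : Set X) →₀ R) := Finsupp.lsubtypeDomain Sᶜ
  let ext : ((Sᶜ : Set X) →₀ R) →ₗ[R] (X →₀ R) := Finsupp.lmapDomain R R Subtype.val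
  have hre (y) : res (ext y) = y := by
    ext z
    exact Finsupp.mapDomain_apply Subtype.val_injective y z
  have hres (x) : res x = 0 ↔ x ∈ D ⊔ D.map f := by
    rw [← hD.2, Finsupp.mem_supported']
    exact ⟨fun hx z hz => DFunLike.congr_fun hx ⟨z, hz⟩, fun hx => Finsupp.ext fun z => hx z z.2⟩
  have hresD {d} (hd : d ∈ D) : res d = 0 := (hres d).2 (Submodule.mem_sup_left hd)
  have hresf {d} (hd : d ∈ D) : res (f d) = 0 := (hres _).2 (Submodule.mem_sup_right ⟨d, hd, rfl⟩)
  have hresmap {x} (hx : res (f x) = 0) : ∃ d ∈ D, f d = f x :=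
    hD.mem_map hff (by rwa [hD.2, ← hres])
  let g : ((Sᶜ : Set X) →₀ R) →ₗ[R] ((Sᶜ : Set X) →₀ R) := res ∘ₗ f ∘ₗ ext
  have hg (y) : g y = res (f (ext y)) := rfl
  have hgr (x) : g (res x) = res (f x) := by
    obtain ⟨d, hd, _, ⟨d', hd', rfl⟩, hdd⟩ := Submodule.mem_sup.1
      ((hres (ext (res x) - x)).1 (by rw [map_sub, hre, sub_self]))
    rw [hg, ← sub_eq_zero, ← map_sub, ← map_sub, ← hdd, map_add, hff, add_zero, hresf hd]
  have hgg : LinearMap.range g = LinearMap.ker g := by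
    ext y
    constructor
    · rintro ⟨x, rfl⟩
      rw [LinearMap.mem_ker, hg x, hgr, hff, map_zero]
    · intro hy
      obtain ⟨d, hd, hdy⟩ := hresmap (x := ext y) hy
      have hz : ext y - d ∈ LinearMap.range f := by
        rw [hf, LinearMap.mem_ker, map_sub, hdy, sub_self]
      obtain ⟨z, hz⟩ := hz
      refine ⟨res z, ?_⟩
      rw [hgr, hz, map_sub, hresD hd, hre, sub_zero]
  have : Module.Flat R (LinearMap.range g) := by
    refine TorInjectiveVanishes.flat (K := D.map f) (P := LinearMap.range f)
      (EmbedsInProjective.torInjectiveVanishes h (.submodule _))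
      (i := Submodule.inclusion (LinearMap.map_le_range (f := f) (p := D)))
      (p := (res ∘ₗ Submodule.subtype _).codRestrict _ ?_)
      (Submodule.inclusion_injective _) ?_ ?_
    · rintro ⟨_, x, rfl⟩
      exact ⟨res x, hgr x⟩
    · rintro ⟨_, y, rfl⟩
      exact ⟨⟨f (ext y), _, rfl⟩, rfl⟩
    · ext ⟨_, x, rfl⟩
      constructor
      · rintro ⟨⟨_, d, hd, rfl⟩, hdx⟩
        refine Subtype.ext ?_
        rw [← hdx]
        exact hresf hd
      · intro hx
        obtain ⟨d, hd, hdx⟩ := hresmap (x := x) (congrArg Subtype.val hx)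
        exact ⟨⟨f d, d, hd, rfl⟩, Subtype.ext hdx⟩
  obtain ⟨v, hv⟩ : ∃ v, v ∉ Finsupp.supported R R S := by
    by_contra! hv
    exact hS (eq_top_iff.2 fun v _ => hv v)
  obtain ⟨x₀, hx₀, hvx⟩ : ∃ x ∉ S, v x ≠ 0 := by simpa [Finsupp.mem_supported'] using hv
  obtain ⟨E, T, hxT, hE, hET⟩ := exists_split_summand h hgg ⟨x₀, hx₀⟩
  have hext {y} (hy : y ∈ E) : ext y ∈ D ⊔ E.map ext := Submodule.mem_sup_right ⟨y, hy, rfl⟩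
  have hS' : Finsupp.supported R R {x | ∀ hx : x ∉ S, (⟨x, hx⟩ : (Sᶜ : Set X)) ∈ T} =
      (D ⊔ E.map ext) ⊔ (D ⊔ E.map ext).map f := by
    have hmem (x) : x ∈ Finsupp.supported R R {x | ∀ hx : x ∉ S, (⟨x, hx⟩ : (Sᶜ : Set X)) ∈ T} ↔
        res x ∈ E ⊔ E.map g := by
      rw [← hET, Finsupp.mem_supported', Finsupp.mem_supported']
      constructor
      · intro hx z hz
        exact hx z fun h => hz (h z.2)
      · intro hx z hz
        simp only [Set.mem_ofPred_eq, not_forall] at hz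
        obtain ⟨hzS, hz⟩ := hz
        exact hx ⟨z, hzS⟩ hz
    refine le_antisymm (fun x hx => ?_) ?_
    · obtain ⟨y, hy, _, ⟨z, hz, rfl⟩, hyz⟩ := Submodule.mem_sup.1 ((hmem x).1 hx)
      have hr : x - ext y - f (ext z) ∈ D ⊔ D.map f := by
        rw [← hres, map_sub, map_sub, hre, ← hyz, hg]
        abel
      have hx' : x = (x - ext y - f (ext z)) + (ext y + f (ext z)) := by abel
      rw [hx']
      exact add_mem ((sup_le_sup le_sup_left (Submodule.map_mono le_sup_left) : D ⊔ D.map f ≤ _) hr)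
        (Submodule.add_mem_sup (hext hy) ⟨_, hext hz, rfl⟩)
    · simp only [sup_le_iff, Submodule.map_le_iff_le_comap]
      refine ⟨⟨fun d hd => ?_, fun y hy => ?_⟩, fun d hd => ?_, fun y hy => ?_⟩
      · rw [hmem, hresD hd]
        exact zero_mem _
      · rw [Submodule.mem_comap, hmem, hre]
        exact Submodule.mem_sup_left hy
      · rw [Submodule.mem_comap, hmem, hresf hd]
        exact zero_mem _
      · rw [Submodule.mem_comap, Submodule.mem_comap, hmem, ← hg]
        exact Submodule.mem_sup_right ⟨y, hy, rfl⟩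
  refine ⟨D ⊔ E.map ext, _, ⟨?_, hS'⟩, lt_of_le_not_ge le_sup_left fun hle => ?_⟩
  · rw [Submodule.disjoint_def]
    intro x hx hfx
    obtain ⟨d, hd, _, ⟨y, hy, rfl⟩, rfl⟩ := Submodule.mem_sup.1 hx
    have hsum : f d + f (ext y) = 0 := by rw [← map_add]; exact hfx
    have hy0 : y = 0 := by
      refine Submodule.disjoint_def.1 hE y hy ?_
      rw [LinearMap.mem_ker, hg, eq_neg_of_add_eq_zero_right hsum, map_neg, hresf hd, neg_zero]
    rw [hy0, map_zero, map_zero, add_zero] at hsum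
    rw [hy0, map_zero, add_zero]
    exact Submodule.disjoint_def.1 hD.1 d hd hsum
  · refine hvx ?_
    have hmem : Finsupp.single x₀ (v x₀) ∈ Finsupp.supported R R S := by
      rw [hD.2]
      refine (sup_le_sup hle (Submodule.map_mono hle) : _ ≤ D ⊔ D.map f) ?_
      rw [← hS']
      exact Finsupp.single_mem_supported R _ fun _ => hxT
    simpa using (Finsupp.mem_supported' _ _).1 hmem x₀ hx₀

/-- Over a Gorenstein hereditary ring, a flat module which is periodic with respect to a free
module is projective. -/
lemma projective_range_of_flat_of_free (h : IsGHereditaryRing R)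
    (hf : LinearMap.range f = LinearMap.ker f) [Module.Flat R (LinearMap.range f)] :
    Module.Projective R (LinearMap.range f) := by
  have hff (x) : f (f x) = 0 := (exact_of_range_eq_ker hf).apply_apply_eq_zero x
  obtain ⟨D, -, ⟨S, hD⟩, hmax⟩ := zorn_le_nonempty₀ {D | ∃ S, IsSplitSubmodule f D S} (by
    intro c hc hchain D₀ hD₀
    have : Nonempty c := ⟨⟨D₀, hD₀⟩⟩
    choose S hS using fun D : c => hc D.2
    refine ⟨sSup c, ⟨⋃ D, S D, ?_, ?_⟩, fun D hD => le_sSup hD⟩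
    · rw [Submodule.disjoint_def]
      intro x hx hfx
      obtain ⟨D, hD, hxD⟩ := (Submodule.mem_sSup_of_directed ⟨D₀, hD₀⟩ hchain.directedOn).1 hx
      exact Submodule.disjoint_def.1 (hS ⟨D, hD⟩).1 x hxD hfx
    · rw [Finsupp.supported_iUnion, sSup_eq_iSup', Submodule.map_iSup, ← iSup_sup_eq]
      exact iSup_congr fun D => (hS D).2) ⊥ ⟨∅, disjoint_bot_left, by simp⟩
  have htop : Finsupp.supported R R S = ⊤ := by
    by_contra hS
    obtain ⟨D', S', hD', hlt⟩ := hD.exists_lt h hf hS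
    exact hlt.not_ge (hmax ⟨S', hD'⟩ hlt.le)
  have hrange : LinearMap.range f = D.map f := by
    refine le_antisymm ?_ LinearMap.map_le_range
    rintro _ ⟨x, rfl⟩
    exact hD.mem_map hff (htop ▸ Submodule.mem_top)
  rw [hrange]
  exact hD.projective_map hff

end FlatPeriodicProjective

section FlatEmbedded

open DirectSum

open TensorProduct in
lemma flat_prod (M N : Type*) [AddCommGroup M] [Module R M] [AddCommGroup N] [Module R N]
    [Module.Flat R M] [Module.Flat R N] : Module.Flat R (M × N) := by
  refine Module.Flat.iff_rTensor_injective'.2 fun I => ?_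
  have hcomm : (prodRight R R R M N).toLinearMap ∘ₗ I.subtype.rTensor (M × N) =
      (I.subtype.rTensor M).prodMap (I.subtype.rTensor N) ∘ₗ (prodRight R R I M N).toLinearMap := by
    ext <;> simp
  have hinj : Function.Injective
      ((prodRight R R R M N).toLinearMap ∘ₗ I.subtype.rTensor (M × N)) := by
    rw [hcomm]
    exact ((Module.Flat.rTensor_preserves_injective_linearMap _ I.subtype_injective).prodMap
      (Module.Flat.rTensor_preserves_injective_linearMap _ I.subtype_injective)).comp
      (prodRight R R I M N).injective
  exact Function.Injective.of_comp hinj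

lemma projective_range_of_flat_of_moduleFree (h : IsGHereditaryRing R) {W : Type u}
    [AddCommGroup W] [Module R W] [Module.Free R W] {f : W →ₗ[R] W}
    (hf : LinearMap.range f = LinearMap.ker f) [Module.Flat R (LinearMap.range f)] :
    Module.Projective R (LinearMap.range f) := by
  let e := (Module.Free.chooseBasis R W).repr
  let g := e.toLinearMap ∘ₗ f ∘ₗ e.symm.toLinearMap
  have hrange : (LinearMap.range f).map e.toLinearMap = LinearMap.range g := by
    simp [g, LinearMap.range_comp]
  let e' : LinearMap.range f ≃ₗ[R] LinearMap.range g :=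
    (e.submoduleMap _).trans (LinearEquiv.ofEq _ _ hrange)
  have : Module.Flat R (LinearMap.range g) := Module.Flat.of_linearEquiv e'.symm
  have hg : LinearMap.range g = LinearMap.ker g := by
    rw [← hrange, hf]
    ext x
    simp [g, Submodule.mem_map_equiv]
  have := projective_range_of_flat_of_free h hg
  exact Module.Projective.of_equiv e'.symm

/-- Over a Gorenstein hereditary ring, a flat module which is periodic with respect to a projective
module is projective. -/
lemma projective_range_of_flat (h : IsGHereditaryRing R) {P : Type u} [AddCommGroup P] [Module R P]
    [Module.Projective R P] {f : P →ₗ[R] P} (hf : LinearMap.range f = LinearMap.ker f)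
    [Module.Flat R (LinearMap.range f)] : Module.Projective R (LinearMap.range f) := by
  have hff (x) : f (f x) = 0 := (exact_of_range_eq_ker hf).apply_apply_eq_zero x
  obtain ⟨s, hs⟩ := Module.projective_def'.1 ‹Module.Projective R P›
  let π : (P →₀ R) →ₗ[R] P := Finsupp.linearCombination R id
  have hπ (p) : π (s p) = p := LinearMap.congr_fun hs p
  let g : (P →₀ R) × (P →₀ R) →ₗ[R] (P →₀ R) × (P →₀ R) :=
    ((s ∘ₗ f ∘ₗ π) ∘ₗ .fst R _ _ + (LinearMap.id - s ∘ₗ π) ∘ₗ .snd R _ _).prod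
      ((s ∘ₗ f ∘ₗ π) ∘ₗ .snd R _ _)
  have hg (w) : g w = (s (f (π w.1)) + (w.2 - s (π w.2)), s (f (π w.2))) := rfl
  have hπg (w) : π (g w).1 = f (π w.1) := by simp [hg, hπ]
  have hπg' (w) : π (g w).2 = f (π w.2) := by simp [hg, hπ]
  have hgmem (p q w) : g (s p, s q + (w - s (π w))) = (s (f p) + (w - s (π w)), s (f q)) := by
    simp [hg, hπ]
  have hgg : LinearMap.range g = LinearMap.ker g := by
    ext w
    constructor
    · rintro ⟨v, rfl⟩
      rw [LinearMap.mem_ker, hg (g v), hπg, hπg', hff, hff]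
      simp [hg]
    · intro hw
      have h₁ : f (π w.1) = 0 := by rw [← hπg, hw]; exact map_zero π
      have h₂ : f (π w.2) = 0 := by rw [← hπg', hw]; exact map_zero π
      have h₃ : w.2 - s (π w.2) = 0 := by
        have := congrArg Prod.fst (LinearMap.mem_ker.1 hw)
        simpa [hg, h₁] using this
      obtain ⟨p, hp⟩ : π w.1 ∈ LinearMap.range f := by rwa [hf]
      obtain ⟨q, hq⟩ : π w.2 ∈ LinearMap.range f := by rwa [hf]
      refine ⟨_, (hgmem p q w.1).trans ?_⟩
      rw [hp, hq]
      exact Prod.ext (by simp) (sub_eq_zero.1 h₃).symm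
  have : Module.Flat R (LinearMap.range g) := by
    let a : LinearMap.range g →ₗ[R] (LinearMap.range f × LinearMap.range f) × (P →₀ R) :=
      (((π ∘ₗ .fst R _ _ ∘ₗ Submodule.subtype _).codRestrict _ (by
        rintro ⟨_, v, rfl⟩
        exact ⟨_, (hπg v).symm⟩)).prod ((π ∘ₗ .snd R _ _ ∘ₗ Submodule.subtype _).codRestrict _ (by
        rintro ⟨_, v, rfl⟩
        exact ⟨_, (hπg' v).symm⟩))).prod (.fst R _ _ ∘ₗ Submodule.subtype _)
    let b : (LinearMap.range f × LinearMap.range f) × (P →₀ R) →ₗ[R] LinearMap.range g :=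
      LinearMap.codRestrict _
        ((s ∘ₗ Submodule.subtype _ ∘ₗ .fst R _ _ ∘ₗ .fst R _ _ +
          (LinearMap.id - s ∘ₗ π) ∘ₗ .snd R _ _).prod
          (s ∘ₗ Submodule.subtype _ ∘ₗ .snd R _ _ ∘ₗ .fst R _ _)) (by
        rintro ⟨⟨⟨_, p, rfl⟩, _, q, rfl⟩, w⟩
        exact ⟨_, hgmem p q w⟩)
    have := flat_prod (R := R) (LinearMap.range f) (LinearMap.range f)
    have := flat_prod (R := R) (LinearMap.range f × LinearMap.range f) (P →₀ R)
    refine Module.Flat.of_retract a b ?_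
    ext1 ⟨_, v, rfl⟩
    refine Subtype.ext (Prod.ext ?_ ?_)
    · change s (π (g v).1) + ((g v).1 - s (π (g v).1)) = (g v).1
      abel
    · change s (π (g v).2) = (g v).2
      rw [hπg']
      rfl
  have := projective_range_of_flat_of_moduleFree h hgg
  refine Module.Projective.of_split (M := LinearMap.range g)
    ((LinearMap.inl R _ _ ∘ₗ s ∘ₗ Submodule.subtype _).codRestrict _ ?_)
    ((π ∘ₗ .fst R _ _ ∘ₗ Submodule.subtype _).codRestrict _ ?_) ?_
  · rintro ⟨_, p, rfl⟩
    exact ⟨_, (hgmem p 0 0).trans (by simp)⟩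
  · rintro ⟨_, v, rfl⟩
    exact ⟨_, (hπg v).symm⟩
  · ext1 x
    exact Subtype.ext (hπ x)

/-- Over a Gorenstein hereditary ring, flat submodules of projective modules are projective. -/
lemma EmbedsInProjective.projective_of_flat (h : IsGHereditaryRing R) {F : Type u}
    [AddCommGroup F] [Module R F] [Module.Flat R F] (hF : EmbedsInProjective (R := R) F) :
    Module.Projective R F := by
  classical
  obtain ⟨P, _, _, d, hP, hd, ⟨e⟩, -⟩ := hF.isGorensteinProjective h
  have hdd (i) (x) : d (i + 1) (d i x) = 0 := (exact_of_range_eq_ker (hd i)).apply_apply_eq_zero x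
  have hmem (i) (x) : d i x ∈ LinearMap.ker (d (i + 1)) := hdd i x
  have hstep (i : ℤ) : Module.Flat R (LinearMap.range (d i)) ↔
      Module.Flat R (LinearMap.range (d (i + 1))) := by
    have hexact : LinearMap.range (LinearMap.range (d i)).subtype =
        LinearMap.ker (d (i + 1)).rangeRestrict := by
      rw [Submodule.range_subtype, LinearMap.ker_rangeRestrict, hd]
    constructor
    · intro
      exact TorInjectiveVanishes.flat (EmbedsInProjective.torInjectiveVanishes h (.submodule _))
        (Submodule.subtype_injective _) (LinearMap.surjective_rangeRestrict _) hexact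
    · intro
      exact flat_of_exact_of_flat (Submodule.subtype_injective _)
        (LinearMap.surjective_rangeRestrict _) hexact
  have hflat (i : ℤ) : Module.Flat R (LinearMap.range (d i)) := by
    induction i with
    | zero => exact Module.Flat.of_linearEquiv e.symm
    | succ n ih => exact (hstep n).1 ih
    | pred n ih =>
      refine (hstep _).2 ?_
      rwa [sub_add_cancel]
  let f : (⨁ i, P i) →ₗ[R] ⨁ i, P i := directSumShift (fun i => i + 1) d
  have hs : Function.Injective fun i : ℤ => i + 1 := add_left_injective 1
  have hf (x k) : f x (k + 1) = d k (x k) := directSumShift_apply hs d x k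
  have hff : LinearMap.range f = LinearMap.ker f := by
    refine le_antisymm ?_ fun x hx => ?_
    · rintro _ ⟨x, rfl⟩
      refine DFinsupp.ext fun k => ?_
      obtain ⟨k, rfl⟩ : ∃ j, k = j + 1 := ⟨k - 1, by simp⟩
      obtain ⟨k, rfl⟩ : ∃ j, k = j + 1 := ⟨k - 1, by simp⟩
      rw [hf, hf, hdd]
      rfl
    · rw [← DirectSum.sum_support_of x]
      refine Submodule.sum_mem _ fun k _ => ?_
      have hk : d k (x k) = 0 := by
        rw [← hf, LinearMap.mem_ker.1 hx]
        rfl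
      generalize x k = y at hk
      obtain ⟨k, rfl⟩ : ∃ j, k = j + 1 := ⟨k - 1, by simp⟩
      obtain ⟨z, rfl⟩ : y ∈ LinearMap.range (d k) := by
        rw [hd]
        exact hk
      exact ⟨lof R ℤ P k z, directSumShift_lof _ _ _ _⟩
  let Ψ : (⨁ i, LinearMap.range (d i)) →ₗ[R] ⨁ i, P i :=
    directSumShift (fun i => i + 1) fun i => (LinearMap.range (d i)).subtype
  have hΨ : Function.Injective Ψ := by
    refine (injective_iff_map_eq_zero _).2 fun x hx => DFinsupp.ext fun k => Subtype.ext ?_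
    have := directSumShift_apply hs (fun i => (LinearMap.range (d i)).subtype) x k
    exact this.symm.trans (by change Ψ x (k + 1) = 0; rw [hx]; rfl)
  have hΨd (i) (z : P i) : Ψ (lof R ℤ (fun i => LinearMap.range (d i)) i ⟨d i z, z, rfl⟩) =
      f (lof R ℤ P i z) :=
    (directSumShift_lof (fun i => i + 1) (fun i => (LinearMap.range (d i)).subtype) _ _).trans
      (directSumShift_lof (fun i => i + 1) d i z).symm
  have hΨf : LinearMap.range Ψ = LinearMap.range f := by
    refine le_antisymm ?_ ?_
    · rintro _ ⟨x, rfl⟩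
      induction x using DirectSum.induction_on with
      | zero => simp
      | of i y =>
        obtain ⟨_, z, rfl⟩ := y
        exact ⟨lof R ℤ P i z, (hΨd i z).symm⟩
      | add x y hx hy =>
        rw [map_add]
        exact add_mem hx hy
    · rintro _ ⟨x, rfl⟩
      induction x using DirectSum.induction_on with
      | zero => simp
      | of i y => exact ⟨_, hΨd i y⟩
      | add x y hx hy =>
        rw [map_add]
        exact add_mem hx hy
  let E : (⨁ i, LinearMap.range (d i)) ≃ₗ[R] LinearMap.range f :=
    (LinearEquiv.ofInjective Ψ hΨ).trans (LinearEquiv.ofEq _ _ hΨf)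
  have : Module.Flat R (LinearMap.range f) := Module.Flat.of_linearEquiv E.symm
  have := projective_range_of_flat h hff
  have := Module.Projective.directSum_iff.1 (Module.Projective.of_equiv E.symm) 0
  exact Module.Projective.of_equiv e.symm

lemma IsStronglyGorensteinFlat.isStronglyGorensteinProjective (h : IsGHereditaryRing R)
    {M : Type u} [AddCommGroup M] [Module R M] (hM : IsStronglyGorensteinFlat R M)
    (hM' : IsGorensteinProjective R M) : IsStronglyGorensteinProjective R M := by
  obtain ⟨F, _, _, f, hF, hf, ⟨e⟩, -⟩ := hM
  have hG := hM'.of_equiv e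
  have hf' : LinearMap.range (LinearMap.range f).subtype = LinearMap.ker f.rangeRestrict := by
    rw [Submodule.range_subtype, LinearMap.ker_rangeRestrict, hf]
  have hinj := (LinearMap.range f).subtype_injective
  refine ⟨F, _, _, f, EmbedsInProjective.projective_of_flat h (.of_exact h hinj
    f.surjective_rangeRestrict hf' hG.embedsInProjective hG.embedsInProjective), hf, ⟨e⟩, fun Q _ _ _ g hg => ?_⟩
  obtain ⟨g', hg'⟩ := exists_comp_eq_of_surjective f.surjective_rangeRestrict (g := g) (by
    rw [LinearMap.ker_rangeRestrict, ← hf]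
    rintro _ ⟨x, rfl⟩
    exact LinearMap.congr_fun hg x)
  obtain ⟨ψ, hψ⟩ := hG.exists_extension hinj f.surjective_rangeRestrict hf' g'
  exact ⟨ψ, by rw [← hg', ← hψ]; rfl⟩

end FlatEmbedded

end

/-- Proposition 2.7: characterizations of strongly Gorenstein hereditary rings among
Gorenstein hereditary rings. -/
theorem statement_6 (R : Type u) [CommRing R] (h : IsGHereditaryRing R) :
    List.TFAE
      [ IsSGHereditaryRing R,
        ∀ (M : Type u) (_ : AddCommGroup M) (_ : Module R M),
          IsGorensteinProjective R M → IsStronglyGorensteinProjective R M,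
        IsCoherentRing R ∧
          ∀ (M : Type u) (_ : AddCommGroup M) (_ : Module R M),
            IsGorensteinFlat R M → IsStronglyGorensteinFlat R M ] := by
  tfae_have 1 → 2 := by
    intro hS M _ _ hM
    obtain ⟨P, _, _, i, hP, hi⟩ := hM.embedsInProjective
    exact (hS P _ _ hP (LinearMap.range i)).of_equiv (LinearEquiv.ofInjective i hi).symm
  tfae_have 2 → 1 := fun hS P _ _ hP N => hS N _ _ (h P _ _ hP N)
  tfae_have 1 → 3 := by
    refine fun hS => ⟨h.isCoherentRing, fun M _ _ hM => ?_⟩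
    obtain ⟨P, _, _, G, π, hP, hπ, hK⟩ := h.exists_surjective_ker_projective M
    exact (hM.torInjectiveVanishes h).isStronglyGorensteinFlat (hS P _ _ hP G) π hπ hK
  tfae_have 3 → 2 := fun hS M _ _ hM =>
    (hS.2 M _ _ (hM.isGorensteinFlat h)).isStronglyGorensteinProjective h hM
  tfae_finish
end
end

section
/- A Gorenstein hereditary commutative ring R is hereditary if, and only if, the weak global dimension wdim(R) is finite. -/
noncomputable section

universe u

variable (R : Type u) [CommRing R]

theorem flat_iff_hasInjectiveDimensionLT_one {R : Type u} [CommRing R] {M : Type u}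
    [AddCommGroup M] [Module R M] :
    Module.Flat R M ↔ CategoryTheory.HasInjectiveDimensionLT
      (ModuleCat.of R (CharacterModule M)) 1 := by
  rw [Module.Flat.iff_characterModule_injective, Module.injective_iff_injective_object,
    CategoryTheory.injective_iff_hasInjectiveDimensionLT_one]

/-- Dimension shifting for character modules along `0 → A → F → C → 0` with `F` flat. -/
theorem hasInjectiveDimensionLT_characterModule_iff {R : Type u} [CommRing R] {A F C : Type u}
    [AddCommGroup A] [Module R A] [AddCommGroup F] [Module R F] [AddCommGroup C] [Module R C]
    [Module.Flat R F] (f : A →ₗ[R] F) (g : F →ₗ[R] C) (hf : Function.Injective f)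
    (hfg : Function.Exact f g) (hg : Function.Surjective g) (n : ℕ) :
    CategoryTheory.HasInjectiveDimensionLT (ModuleCat.of R (CharacterModule A)) (n + 1) ↔
      CategoryTheory.HasInjectiveDimensionLT (ModuleCat.of R (CharacterModule C)) (n + 2) := by
  have hexact : Function.Exact (CharacterModule.dual g) (CharacterModule.dual f) := by
    intro φ
    refine ⟨fun hφ => ?_, ?_⟩
    · have hker : g.toAddMonoidHom.ker ≤ AddMonoidHom.ker φ := fun x hx => by
        obtain ⟨y, rfl⟩ := (hfg x).1 hx
        exact DFunLike.congr_fun hφ y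
      refine ⟨g.toAddMonoidHom.liftOfSurjective hg ⟨φ, hker⟩, ?_⟩
      exact AddMonoidHom.liftOfRightInverse_comp _ _ _ _
    · rintro ⟨ψ, rfl⟩
      refine CharacterModule.ext _ fun x => ?_
      exact (congrArg ψ (hfg.apply_apply_eq_zero x)).trans (map_zero ψ)
  have hS := ModuleCat.shortComplex_shortExact
    (ModuleCat.shortComplexOfCompEqZero (CharacterModule.dual g) (CharacterModule.dual f)
      hexact.linearMap_comp_eq_zero) hexact
    (CharacterModule.dual_injective_of_surjective g hg)
    (CharacterModule.dual_surjective_of_injective f hf)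
  exact hS.hasInjectiveDimensionLT_X₃_iff n
    ((Module.injective_iff_injective_object _ _).1
      (Module.Flat.iff_characterModule_injective.1 inferInstance))

theorem FlatDimLE.hasInjectiveDimensionLT_characterModule {R : Type u} [CommRing R] (n : ℕ)
    {M : Type u} [AddCommGroup M] [Module R M] (h : FlatDimLE R M n) :
    CategoryTheory.HasInjectiveDimensionLT (ModuleCat.of R (CharacterModule M)) (n + 1) := by
  induction n generalizing M with
  | zero =>
    obtain ⟨F, _, _, d, ε, hF, h0, hε, hker, -⟩ := h
    have := h0 1 one_pos
    have := hF 0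
    refine flat_iff_hasInjectiveDimensionLT_one.1 (Module.Flat.of_linearEquiv
      (LinearEquiv.ofBijective ε ⟨LinearMap.ker_eq_bot.1 ?_, hε⟩).symm)
    rw [hker]
    exact (LinearMap.range_eq_bot).2 (Subsingleton.elim (α := F 1 →ₗ[R] F 0) _ _)
  | succ n ih =>
    obtain ⟨F, _, _, d, ε, hF, h0, hε, hker, hd⟩ := h
    have := hF 0
    refine (hasInjectiveDimensionLT_characterModule_iff (LinearMap.ker ε).subtype ε
      (Submodule.injective_subtype _) (LinearMap.exact_subtype_ker_map ε) hε n).1 (ih ?_)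
    refine ⟨fun i => F (i + 1), fun _ => inferInstance, fun _ => inferInstance, fun i => d (i + 1),
      (d 0).codRestrict _ fun x => hker ▸ LinearMap.mem_range_self _ x, fun i => hF _,
      fun i hi => h0 _ (by omega), ?_, ?_, fun i => hd _⟩
    · rintro ⟨x, hx⟩
      obtain ⟨y, rfl⟩ := hker ▸ hx
      exact ⟨y, rfl⟩
    · rw [LinearMap.ker_codRestrict]
      exact hd 0

/-- A Gorenstein projective module embeds in a projective module with Gorenstein projective
cokernel. -/
theorem IsGorensteinProjective.exists_embedding {R : Type u} [CommRing R] {M : Type u}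
    [AddCommGroup M] [Module R M] (h : IsGorensteinProjective R M) :
    ∃ (Q C : Type u) (_ : AddCommGroup Q) (_ : Module R Q) (_ : AddCommGroup C) (_ : Module R C)
      (f : M →ₗ[R] Q) (g : Q →ₗ[R] C), Module.Projective R Q ∧ IsGorensteinProjective R C ∧
      Function.Injective f ∧ Function.Exact f g ∧ Function.Surjective g := by
  obtain ⟨P, _, _, d, hP, hd, ⟨e⟩, hQ⟩ := h
  refine ⟨P (0 + 1), LinearMap.range (d (0 + 1)), inferInstance, inferInstance, inferInstance,
    inferInstance, (LinearMap.range (d 0)).subtype ∘ₗ e, (d (0 + 1)).rangeRestrict, hP _,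
    ⟨fun i => P (i + 1), fun _ => inferInstance, fun _ => inferInstance, fun i => d (i + 1),
      fun i => hP _, fun i => hd _, ⟨LinearEquiv.refl _ _⟩, fun Q _ _ hQ' i => hQ Q _ _ hQ' _⟩,
    (Submodule.injective_subtype _).comp e.injective, ?_, LinearMap.surjective_rangeRestrict _⟩
  rw [LinearMap.exact_iff, LinearMap.ker_rangeRestrict, ← hd 0,
    LinearMap.range_comp_of_range_eq_top _ (LinearEquiv.range e), Submodule.range_subtype]

/-- A surjection onto a Gorenstein projective module with projective kernel splits. -/
theorem IsGorensteinProjective.exists_section {R : Type u} [CommRing R] {M A : Type u}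
    [AddCommGroup M] [Module R M] [AddCommGroup A] [Module R A] (h : IsGorensteinProjective R M)
    (π : A →ₗ[R] M) (hπ : Function.Surjective π) [Module.Projective R (LinearMap.ker π)] :
    ∃ s : M →ₗ[R] A, π ∘ₗ s = LinearMap.id := by
  obtain ⟨P, _, _, d, hP, hd, he, hQ⟩ := h
  obtain ⟨i, hi⟩ : ∃ i : ℤ, i + 1 + 1 = 0 := ⟨-2, by norm_num⟩
  rw [← hi] at he
  obtain ⟨e⟩ := he
  have := hP (i + 1 + 1)
  let p : P (i + 1 + 1) →ₗ[R] M := e.symm ∘ₗ (d (i + 1 + 1)).rangeRestrict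
  have hp : Function.Surjective p :=
    e.symm.surjective.comp (LinearMap.surjective_rangeRestrict _)
  have hpker : LinearMap.ker p = LinearMap.range (d (i + 1)) := by
    rw [LinearMap.ker_comp_of_ker_eq_bot _ (LinearEquiv.ker _), LinearMap.ker_rangeRestrict, hd]
  obtain ⟨φ, hφ⟩ := Module.projective_lifting_property π p hπ
  have hmem : ∀ x, φ (d (i + 1) x) ∈ LinearMap.ker π := fun x => by
    rw [LinearMap.mem_ker, ← LinearMap.comp_apply, hφ, ← LinearMap.mem_ker, hpker]
    exact LinearMap.mem_range_self _ x
  obtain ⟨k, hk⟩ := hQ (LinearMap.ker π) _ _ inferInstance i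
    ((φ ∘ₗ d (i + 1)).codRestrict _ hmem) (by
      ext x
      have : d (i + 1) (d i x) = 0 := by
        rw [← LinearMap.mem_ker, ← hd i]
        exact LinearMap.mem_range_self _ x
      simp [this])
  have hkill : LinearMap.ker p ≤ LinearMap.ker (φ - (LinearMap.ker π).subtype ∘ₗ k) := by
    rw [hpker]
    rintro _ ⟨x, rfl⟩
    have := congrArg Subtype.val (LinearMap.congr_fun hk x)
    simp only [LinearMap.comp_apply, LinearMap.codRestrict_apply] at this
    simp [this]
  refine ⟨(LinearMap.ker p).liftQ _ hkill ∘ₗ (p.quotKerEquivOfSurjective hp).symm, ?_⟩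
  refine LinearMap.ext fun m => ?_
  obtain ⟨x, rfl⟩ := hp m
  have hx : (p.quotKerEquivOfSurjective hp).symm (p x) = Submodule.Quotient.mk x :=
    (LinearEquiv.symm_apply_eq _).2 rfl
  have h1 : π (k x) = 0 := (k x).2
  simp only [LinearMap.comp_apply, LinearEquiv.coe_coe, hx, LinearMap.id_apply]
  rw [← LinearMap.congr_fun hφ x]
  simp [h1]

theorem IsGorensteinProjective.flat {R : Type u} [CommRing R] {n : ℕ}
    (hR : ∀ (M : Type u) [AddCommGroup M] [Module R M], IsGorensteinProjective R M →
      FlatDimLE R M n)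
    {M : Type u} [AddCommGroup M] [Module R M] (hM : IsGorensteinProjective R M) :
    Module.Flat R M := by
  have key : ∀ k ≤ n, ∀ (M : Type u) [AddCommGroup M] [Module R M], IsGorensteinProjective R M →
      CategoryTheory.HasInjectiveDimensionLT (ModuleCat.of R (CharacterModule M)) (k + 1) := by
    intro k hk
    induction hk using Nat.decreasingInduction with
    | self => exact fun M _ _ hM => (hR M hM).hasInjectiveDimensionLT_characterModule
    | of_succ k _ ih =>
      intro M _ _ hM
      obtain ⟨Q, C, _, _, _, _, f, g, _, hC, hf, hfg, hg⟩ := hM.exists_embedding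
      exact (hasInjectiveDimensionLT_characterModule_iff f g hf hfg hg k).2 (ih C hC)
  exact flat_iff_hasInjectiveDimensionLT_one.2 (key 0 n.zero_le M hM)

theorem Module.Projective.of_exact_of_finite {R : Type u} [CommRing R] {N Q C : Type*}
    [AddCommGroup N] [Module R N] [AddCommGroup Q] [Module R Q] [AddCommGroup C] [Module R C]
    [Module.Finite R N] [Module.Projective R Q] [Module.Flat R C] (f : N →ₗ[R] Q) (g : Q →ₗ[R] C)
    (hf : Function.Injective f) (hfg : Function.Exact f g) (hg : Function.Surjective g) :
    Module.Projective R N := by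
  obtain ⟨s, hs⟩ := Module.projective_def'.1 (inferInstance : Module.Projective R Q)
  obtain ⟨t, ht⟩ := Module.Finite.fg_top (R := R) (M := N)
  classical
  let S : Finset Q := t.biUnion fun x => (s (f x)).support
  have hS : ∀ x, s (f x) ∈ Finsupp.supported R R (S : Set Q) := by
    intro x
    have : (⊤ : Submodule R N) ≤ (Finsupp.supported R R (S : Set Q)).comap (s ∘ₗ f) := by
      rw [← ht, Submodule.span_le]
      intro y hy
      refine (Finsupp.mem_supported R _).2 ?_
      exact_mod_cast Finset.subset_biUnion_of_mem (fun x => (s (f x)).support) hy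
    exact this trivial
  let σ : N →ₗ[R] Finsupp.supported R R (S : Set Q) := (s ∘ₗ f).codRestrict _ hS
  let q : Finsupp.supported R R (S : Set Q) →ₗ[R] Q :=
    Finsupp.linearCombination R id ∘ₗ Submodule.subtype _
  have hq : ∀ x, q (σ x) = f x := fun x => LinearMap.congr_fun hs (f x)
  let e := Finsupp.supportedEquivFinsupp (M := R) (R := R) (S : Set Q)
  have : Module.Finite R (Finsupp.supported R R (S : Set Q)) := .equiv e.symm
  have : Module.Free R (Finsupp.supported R R (S : Set Q)) := .of_equiv e.symm
  obtain ⟨k, a, y, hya, ha⟩ := Module.Flat.exists_factorization_of_comp_eq_zero_of_free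
    (N := Finsupp.supported R R (S : Set Q)) (f := σ) (x := g ∘ₗ q) (by
      ext x
      simp only [LinearMap.comp_apply, hq]
      exact hfg.apply_apply_eq_zero x)
  obtain ⟨z, hz⟩ := Module.projective_lifting_property g y hg
  have hmem : ∀ x, (q - z ∘ₗ a) x ∈ LinearMap.range f := fun x => by
    rw [← hfg.linearMap_ker_eq, LinearMap.mem_ker, LinearMap.sub_apply, map_sub, sub_eq_zero]
    exact (LinearMap.congr_fun hya x).trans (LinearMap.congr_fun hz (a x)).symm
  refine .of_split σ ((LinearEquiv.ofInjective f hf).symm ∘ₗ (q - z ∘ₗ a).codRestrict _ hmem) ?_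
  ext x
  simp only [LinearMap.comp_apply, LinearEquiv.coe_coe, LinearMap.id_apply]
  rw [LinearEquiv.symm_apply_eq]
  ext
  have : a (σ x) = 0 := LinearMap.congr_fun ha x
  simp [hq, this]

theorem IsHereditaryRing.flatDimLE_one {R : Type u} [CommRing R] (h : IsHereditaryRing R)
    (M : Type u) [AddCommGroup M] [Module R M] : FlatDimLE R M 1 := by
  let ε : (M →₀ R) →ₗ[R] M := Finsupp.linearCombination R id
  have hε : Function.Surjective ε := Finsupp.linearCombination_id_surjective R M
  have := h (M →₀ R) _ _ inferInstance (LinearMap.ker ε)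
  let F : ℕ → ModuleCat.{u} R
    | 0 => .of R (M →₀ R)
    | 1 => .of R (LinearMap.ker ε)
    | _ + 2 => .of R PUnit.{u + 1}
  refine ⟨fun i => F i, fun i => inferInstance, fun i => inferInstance,
    fun | 0 => (LinearMap.ker ε).subtype | _ + 1 => 0, ε, ?_, ?_, hε, ?_, ?_⟩
  · rintro (_ | _ | i)
    · exact inferInstanceAs (Module.Flat R (M →₀ R))
    · exact inferInstanceAs (Module.Flat R (LinearMap.ker ε))
    · exact inferInstanceAs (Module.Flat R PUnit.{u + 1})
  · rintro (_ | _ | i) hi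
    · omega
    · omega
    · exact inferInstanceAs (Subsingleton PUnit.{u + 1})
  · exact (Submodule.range_subtype _).symm
  · rintro (_ | i)
    · exact (Submodule.ker_subtype _).trans LinearMap.range_zero.symm
    · have : Subsingleton (F (i + 1 + 1)) := inferInstanceAs (Subsingleton PUnit.{u + 1})
      exact Subsingleton.elim _ _

theorem LinearMap.exists_lift_supported {R : Type*} [CommRing R] {P : Type*} [AddCommGroup P]
    [Module R P] {ι : Type*} [LinearOrder ι] (L M : ι → Submodule R P) (a : ι)
    (hL : L a = ⨆ b, ⨆ _ : b < a, M b) [Module.Projective R (L a)] :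
    ∃ s : L a →ₗ[R] Π₀ b, M b, (∀ y, DFinsupp.lsum ℕ (fun b => (M b).subtype) (s y) = y) ∧
      ∀ y b, a ≤ b → s y b = 0 := by
  let π := DFinsupp.lsum ℕ (fun b => (M b).subtype)
  let A : Submodule R (Π₀ b, M b) :=
    { carrier := {f | ∀ b, a ≤ b → f b = 0}
      add_mem' := fun {f g} hf hg b hb => by simp [hf b hb, hg b hb]
      zero_mem' := fun _ _ => rfl
      smul_mem' := fun c f hf b hb => by simp [hf b hb] }
  have hle : L a ≤ A.map π := by
    rw [hL]
    refine iSup₂_le fun b hb y hy => ⟨DFinsupp.single b ⟨y, hy⟩, fun c hc => ?_, ?_⟩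
    · exact DFinsupp.single_eq_of_ne (hb.trans_le hc).ne'
    · exact DFinsupp.lsum_single ℕ _ _ _
  have hge : A.map π ≤ L a := by
    rintro _ ⟨f, hf, rfl⟩
    refine dfinsuppSumAddHom_mem (L a) f _ fun b hb => ?_
    have hba : b < a := lt_of_not_ge fun h => hb (hf b h)
    rw [hL]
    exact (le_iSup₂ (f := fun b (_ : b < a) => M b) b hba) (f b).2
  let ρ : A →ₗ[R] L a := (π.domRestrict A).codRestrict (L a) fun f => hge ⟨f, f.2, rfl⟩
  have hρ : Function.Surjective ρ := by
    rintro ⟨y, hy⟩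
    obtain ⟨f, hf, rfl⟩ := hle hy
    exact ⟨⟨f, hf⟩, rfl⟩
  obtain ⟨s, hs⟩ := Module.projective_lifting_property ρ LinearMap.id hρ
  refine ⟨A.subtype ∘ₗ s, fun y => ?_, fun y b hb => (s y).2 b hb⟩
  exact congrArg Subtype.val (LinearMap.congr_fun hs y)

/-- If a well-ordered family of projective submodules `M a` is such that each
`L a = ⨆ b < a, M b` is projective and contained in `M a`, then the module of relations between
the `M a` is projective. -/
theorem Module.Projective.ker_lsum_subtype {R : Type*} [CommRing R] {P : Type*} [AddCommGroup P]
    [Module R P] {ι : Type*} [LinearOrder ι] [WellFoundedLT ι] (L M : ι → Submodule R P)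
    (hL : ∀ a, L a = ⨆ b, ⨆ _ : b < a, M b) (hLM : ∀ a, L a ≤ M a)
    [∀ a, Module.Projective R (L a)] :
    Module.Projective R (LinearMap.ker (DFinsupp.lsum ℕ (fun b => (M b).subtype))) := by
  let π := DFinsupp.lsum ℕ (fun b => (M b).subtype)
  choose s hs hs0 using fun a => LinearMap.exists_lift_supported L M a (hL a)
  let φ : ∀ a, L a →ₗ[R] Π₀ b, M b := fun a =>
    DFinsupp.lsingle a ∘ₗ Submodule.inclusion (hLM a) - s a
  let Φ : (Π₀ a, L a) →ₗ[R] Π₀ b, M b := DFinsupp.lsum ℕ φ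
  have hφ : ∀ a y, φ a y = DFinsupp.single a (Submodule.inclusion (hLM a) y) - s a y :=
    fun _ _ => rfl
  have hπφ : ∀ a y, π (φ a y) = 0 := fun a y => by
    rw [hφ, map_sub]
    simp only [π, hs, DFinsupp.lsum_single]
    simp
  have hπΦ : ∀ f, π (Φ f) = 0 := by
    have : π ∘ₗ Φ = 0 := by
      refine DFinsupp.lhom_ext fun a y => ?_
      simp only [LinearMap.comp_apply, Φ, DFinsupp.lsum_single]
      exact hπφ a y
    exact LinearMap.congr_fun this
  have hΦtop : ∀ f a, (∀ b, a < b → f b = 0) → ((Φ f a : M a) : P) = f a := by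
    intro f a hf
    classical
    have h1 : Φ f = f.sum fun b y => φ b y := DFinsupp.sumAddHom_apply _ _
    rw [h1, DFinsupp.sum_apply, DFinsupp.sum, Finset.sum_eq_single a]
    · simp [hφ, hs0]
    · intro b hb hba
      have hlt : b < a := lt_of_le_of_ne
        (le_of_not_gt fun h => (DFinsupp.mem_support_iff.1 hb) (hf b h)) hba
      simp [hφ, hs0 b _ a hlt.le, DFinsupp.single_eq_of_ne hba.symm]
    · intro ha
      simp [DFinsupp.notMem_support_iff.1 ha]
  have hinj : Function.Injective Φ := by
    rw [injective_iff_map_eq_zero]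
    intro f hf
    classical
    by_contra hne
    have hsupp : f.support.Nonempty := Finset.nonempty_iff_ne_empty.2
      fun h => hne (DFinsupp.support_eq_empty.1 h)
    have hmax : ∀ b, f.support.max' hsupp < b → f b = 0 := fun b hb => by
      by_contra h
      exact (f.support.le_max' b (DFinsupp.mem_support_iff.2 h)).not_gt hb
    have := hΦtop f _ hmax
    refine DFinsupp.mem_support_iff.1 (f.support.max'_mem hsupp) (Subtype.ext ?_)
    rw [← this, hf]
    rfl
  have hsurj : ∀ a f, (∀ b, a < b → f b = 0) → π f = 0 → ∃ g, Φ g = f := by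
    intro a
    induction a using WellFoundedLT.induction with
    | ind a ih =>
    intro f hf hπf
    classical
    have hrest : π (f.erase a) ∈ L a := by
      refine dfinsuppSumAddHom_mem (L a) _ _ fun b hb => ?_
      have hba : b < a := by
        by_contra h
        rcases (not_lt.1 h).eq_or_lt with rfl | h'
        · simp at hb
        · exact hb (by rw [DFinsupp.erase_ne h'.ne', hf b h'])
      rw [hL]
      exact (le_iSup₂ (f := fun b (_ : b < a) => M b) b hba) ((f.erase a) b).2
    have hsplit : DFinsupp.single a (f a) + f.erase a = f := DFinsupp.single_add_erase a f
    have hfa : (f a : P) ∈ L a := by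
      have h1 : π (DFinsupp.single a (f a)) = f a := DFinsupp.lsum_single ℕ _ _ _
      have h2 : (f a : P) + π (f.erase a) = 0 := by rw [← h1, ← map_add, hsplit, hπf]
      rw [eq_neg_of_add_eq_zero_left h2]
      exact neg_mem hrest
    let f' := f - φ a ⟨f a, hfa⟩
    have hf' : ∀ b, a ≤ b → f' b = 0 := by
      intro b hb
      rcases hb.eq_or_lt with rfl | hb'
      · simp only [f', hφ, DFinsupp.sub_apply, hs0 a _ a le_rfl, DFinsupp.single_eq_same,
          sub_zero]
        exact sub_self _
      · simp [f', hφ, hs0 a _ b hb, hf b hb', DFinsupp.single_eq_of_ne hb'.ne']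
    have hπf' : π f' = 0 := by simp only [f', map_sub, hπf, hπφ, sub_zero]
    have hg : ∃ g, Φ g = f' := by
      by_cases hne : f' = 0
      · exact ⟨0, by rw [hne, map_zero]⟩
      · have hsupp : f'.support.Nonempty := Finset.nonempty_iff_ne_empty.2
          fun h => hne (DFinsupp.support_eq_empty.1 h)
        refine ih (f'.support.max' hsupp) ?_ f' (fun b hb => ?_) hπf'
        · by_contra h
          exact DFinsupp.mem_support_iff.1 (f'.support.max'_mem hsupp) (hf' _ (not_lt.1 h))
        · by_contra h
          exact (f'.support.le_max' b (DFinsupp.mem_support_iff.2 h)).not_gt hb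
    obtain ⟨g, hg⟩ := hg
    refine ⟨g + DFinsupp.single a ⟨f a, hfa⟩, ?_⟩
    rw [map_add, hg]
    simp only [Φ, DFinsupp.lsum_single, f', sub_add_cancel]
  let Ψ : (Π₀ a, L a) →ₗ[R] LinearMap.ker π := Φ.codRestrict _ hπΦ
  refine .of_equiv (LinearEquiv.ofBijective Ψ ⟨fun f g h => hinj (congrArg Subtype.val h), ?_⟩)
  rintro ⟨f, hf⟩
  classical
  by_cases hne : f = 0
  · exact ⟨0, Subtype.ext (by simp [hne])⟩
  have hsupp : f.support.Nonempty := Finset.nonempty_iff_ne_empty.2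
    fun h => hne (DFinsupp.support_eq_empty.1 h)
  obtain ⟨g, hg⟩ := hsurj (f.support.max' hsupp) f (fun b hb => by
    by_contra h
    exact (f.support.le_max' b (DFinsupp.mem_support_iff.2 h)).not_gt hb) hf
  exact ⟨g, Subtype.ext hg⟩

/-- Submodules of projective modules are projective as soon as they are Gorenstein projective and
the finitely generated ones are projective. -/
theorem IsGHereditaryRing.projective_span {R : Type u} [CommRing R] (h : IsGHereditaryRing R)
    {P : Type u} [AddCommGroup P] [Module R P] [Module.Projective R P]
    (hfg : ∀ N : Submodule R P, N.FG → Module.Projective R N) (c : Cardinal.{u}) :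
    ∀ (s : Set P), Cardinal.mk s = c → Module.Projective R (Submodule.span R s) := by
  induction c using WellFoundedLT.induction with
  | ind c ih =>
  rintro s rfl
  rcases lt_or_ge (Cardinal.mk s) Cardinal.aleph0 with hfin | hinf
  · exact hfg _ (Submodule.fg_span (Cardinal.lt_aleph0_iff_set_finite.1 hfin))
  obtain ⟨_, _, ho⟩ := Cardinal.exists_ord_eq_type_lt s
  have hIio : ∀ a : s, Cardinal.mk (Set.Iio a) < Cardinal.mk s := fun a =>
    Cardinal.mk_Iio_lt a ho
  have hIic : ∀ a : s, Cardinal.mk (Set.Iic a) < Cardinal.mk s := fun a => by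
    rw [← Set.Iio_insert]
    exact Cardinal.mk_insert_le.trans_lt (Cardinal.add_lt_of_lt hinf (hIio a)
      (Cardinal.one_lt_aleph0.trans_le hinf))
  let L : s → Submodule R P := fun a => Submodule.span R (Subtype.val '' Set.Iio a)
  let M : s → Submodule R P := fun a => Submodule.span R (Subtype.val '' Set.Iic a)
  have hLproj : ∀ a, Module.Projective R (L a) := fun a =>
    ih _ (Cardinal.mk_image_le.trans_lt (hIio a)) _ rfl
  have hMproj : ∀ a, Module.Projective R (M a) := fun a =>
    ih _ (Cardinal.mk_image_le.trans_lt (hIic a)) _ rfl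
  have hL : ∀ a, L a = ⨆ b, ⨆ _ : b < a, M b := fun a => by
    refine le_antisymm (Submodule.span_le.2 ?_) (iSup₂_le fun b hb => Submodule.span_mono ?_)
    · rintro _ ⟨b, hb, rfl⟩
      exact (le_iSup₂ (f := fun b (_ : b < a) => M b) b hb)
        (Submodule.subset_span ⟨b, Set.self_mem_Iic, rfl⟩)
    · exact Set.image_mono fun x hx => lt_of_le_of_lt hx hb
  have hLM : ∀ a, L a ≤ M a := fun a =>
    Submodule.span_mono (Set.image_mono Set.Iio_subset_Iic_self)
  let π := DFinsupp.lsum ℕ (fun b => (M b).subtype)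
  have hker : Module.Projective R (LinearMap.ker π) :=
    Module.Projective.ker_lsum_subtype L M hL hLM
  have hrange : LinearMap.range π = Submodule.span R s := by
    rw [← Submodule.iSup_eq_range_dfinsupp_lsum]
    refine le_antisymm (iSup_le fun a => Submodule.span_mono ?_) (Submodule.span_le.2 ?_)
    · rintro _ ⟨x, -, rfl⟩
      exact x.2
    · intro x hx
      exact (le_iSup M ⟨x, hx⟩) (Submodule.subset_span ⟨⟨x, hx⟩, Set.self_mem_Iic, rfl⟩)
  rw [← hrange]
  have : Module.Projective R (LinearMap.ker π.rangeRestrict) := by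
    rwa [LinearMap.ker_rangeRestrict]
  obtain ⟨t, ht⟩ := (h P _ _ inferInstance (LinearMap.range π)).exists_section π.rangeRestrict
    π.surjective_rangeRestrict
  exact .of_split t π.rangeRestrict ht

/-- Remark 2.8: a Gorenstein hereditary ring is hereditary if and only if its weak global
dimension is finite. -/
theorem statement_7 (R : Type u) [CommRing R] (h : IsGHereditaryRing R) :
    IsHereditaryRing R ↔
      ∃ n : ℕ, ∀ (M : Type u) (_ : AddCommGroup M) (_ : Module R M), FlatDimLE R M n := by
  refine ⟨fun hR => ⟨1, fun M _ _ => hR.flatDimLE_one M⟩, ?_⟩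
  rintro ⟨n, hn⟩ P _ _ _ N
  rw [← N.span_eq]
  refine h.projective_span (fun N' hN' => ?_) _ _ rfl
  obtain ⟨Q, C, _, _, _, _, f, g, _, hC, hf, hfg, hg⟩ :=
    (h P _ _ inferInstance N').exists_embedding
  have := hC.flat fun M _ _ _ => hn M _ _
  have := Module.Finite.iff_fg.2 hN'
  exact .of_exact_of_finite f g hf hfg hg
end
end

section
/- Let K be a field, R = K[X]/(X²), and let S be a non-Noetherian hereditary commutative ring. Then the product ring R × S is strongly Gorenstein hereditary but not hereditary. -/
noncomputable section

universe u

variable (R : Type u) [CommRing R]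

open scoped TensorProduct

theorem Module.Projective.of_algebra {T A M : Type*} [CommRing T] [CommRing A] [Algebra T A]
    [AddCommGroup M] [Module T M] [Module A M] [IsScalarTower T A M]
    [Module.Projective T A] [Module.Projective A M] : Module.Projective T M := by
  classical
  obtain ⟨s, hs⟩ := Module.projective_def'.mp (‹Module.Projective A M›)
  have : Module.Projective T (M →₀ A) :=
    Module.Projective.of_equiv' (finsuppLequivDFinsupp (M := A) (ι := M) T).symm
  refine Module.Projective.of_split (s.restrictScalars T)
    ((Finsupp.linearCombination A id).restrictScalars T) ?_
  ext m
  exact LinearMap.congr_fun hs m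

namespace IsStronglyGorensteinProjective

variable {T : Type u} [CommRing T]

theorem of_equiv_s8 {M N : Type u} [AddCommGroup M] [Module T M] [AddCommGroup N] [Module T N]
    (e : N ≃ₗ[T] M) (h : IsStronglyGorensteinProjective T M) :
    IsStronglyGorensteinProjective T N := by
  obtain ⟨P, _, _, f, hP, hf, ⟨i⟩, hom⟩ := h
  exact ⟨P, _, _, f, hP, hf, ⟨e.trans i⟩, hom⟩

theorem of_projective (M : Type u) [AddCommGroup M] [Module T M] [Module.Projective T M] :
    IsStronglyGorensteinProjective T M := by
  have hr : LinearMap.range (LinearMap.inr T M M ∘ₗ LinearMap.fst T M M) =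
      LinearMap.range (LinearMap.inr T M M) :=
    LinearMap.range_comp_of_range_eq_top _ (LinearMap.range_eq_top.mpr LinearMap.fst_surjective)
  refine ⟨M × M, _, _, LinearMap.inr T M M ∘ₗ LinearMap.fst T M M, inferInstance, ?_,
    ⟨(LinearEquiv.ofInjective (LinearMap.inr T M M) LinearMap.inr_injective).trans
      (LinearEquiv.ofEq _ _ hr.symm)⟩, ?_⟩
  · rw [hr, LinearMap.ker_comp_of_ker_eq_bot _ (LinearMap.ker_eq_bot.mpr LinearMap.inr_injective),
      LinearMap.range_inr]
  · intro Q _ _ _ g hg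
    refine ⟨g ∘ₗ LinearMap.inl T M M ∘ₗ LinearMap.snd T M M, ?_⟩
    ext m
    · simp
    · have h0 : g (0, 0) = 0 := map_zero g
      simpa [h0] using (LinearMap.congr_fun hg (m, 0)).symm

theorem prod {M N : Type u} [AddCommGroup M] [Module T M] [AddCommGroup N] [Module T N]
    (hM : IsStronglyGorensteinProjective T M) (hN : IsStronglyGorensteinProjective T N) :
    IsStronglyGorensteinProjective T (M × N) := by
  obtain ⟨P, _, _, f, hP, hf, ⟨i⟩, hom⟩ := hM
  obtain ⟨P', _, _, f', hP', hf', ⟨i'⟩, hom'⟩ := hN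
  let j := (LinearMap.range f).subtype ∘ₗ i.toLinearMap
  let j' := (LinearMap.range f').subtype ∘ₗ i'.toLinearMap
  have hj : Function.Injective (j.prodMap j') :=
    (Subtype.val_injective.comp i.injective).prodMap (Subtype.val_injective.comp i'.injective)
  have hr : LinearMap.range (f.prodMap f') = LinearMap.range (j.prodMap j') := by
    simp [j, j', LinearMap.range_prodMap, LinearMap.range_comp]
  refine ⟨P × P', _, _, f.prodMap f', inferInstance, ?_,
    ⟨(LinearEquiv.ofInjective _ hj).trans (LinearEquiv.ofEq _ _ hr.symm)⟩, ?_⟩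
  · rw [LinearMap.range_prodMap, LinearMap.ker_prodMap, hf, hf']
  · intro Q _ _ hQ g hg
    obtain ⟨h, hh⟩ := hom Q _ _ hQ (g ∘ₗ LinearMap.inl T P P') (by
      ext p; simpa using LinearMap.congr_fun hg (p, 0))
    obtain ⟨h', hh'⟩ := hom' Q _ _ hQ (g ∘ₗ LinearMap.inr T P P') (by
      ext p; simpa using LinearMap.congr_fun hg (0, p))
    refine ⟨h.coprod h', ?_⟩
    ext p
    · simpa using LinearMap.congr_fun hh p
    · simpa using LinearMap.congr_fun hh' p

/-- Strong Gorenstein projectivity over `A` implies it over `T` if `T → A` is onto and makes `A` a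
projective `T`-module. -/
theorem of_algebra {A M : Type u} [CommRing A] [Algebra T A] [Module.Projective T A]
    (hA : Function.Surjective (algebraMap T A)) [AddCommGroup M] [Module T M] [Module A M]
    [IsScalarTower T A M] (h : IsStronglyGorensteinProjective A M) :
    IsStronglyGorensteinProjective T M := by
  obtain ⟨P, _, _, f, hP, hf, ⟨i⟩, hom⟩ := h
  let _ : Module T P := Module.compHom P (algebraMap T A)
  have : IsScalarTower T A P := ⟨fun t a p => by
    rw [Algebra.smul_def, mul_smul]; rfl⟩
  obtain ⟨s, hs⟩ := (Algebra.linearMap T A).exists_rightInverse_of_surjective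
    (LinearMap.range_eq_top.mpr hA)
  have hs1 : algebraMap T A (s 1) = 1 := LinearMap.congr_fun hs 1
  refine ⟨P, _, _, f.restrictScalars T, Module.Projective.of_algebra (A := A), ?_, ⟨?_⟩, ?_⟩
  · ext p
    exact SetLike.ext_iff.mp hf p
  · exact
      { i with
        map_smul' := fun t m => by
          have := i.map_smul (algebraMap T A t) m
          rw [algebraMap_smul] at this
          exact this }
  · intro Q _ _ hQ g hg
    obtain ⟨h, hh⟩ := hom (TensorProduct T A Q) _ _ inferInstance
      { toFun := fun p => 1 ⊗ₜ[T] g p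
        map_add' := by simp [TensorProduct.tmul_add]
        map_smul' := fun a p => by
          obtain ⟨t, rfl⟩ := hA a
          simp [algebraMap_smul] }
      (by
        ext p
        have := LinearMap.congr_fun hg p
        simp only [LinearMap.comp_apply, LinearMap.restrictScalars_apply, LinearMap.zero_apply]
          at this
        simp [this])
    refine ⟨TensorProduct.lift (LinearMap.lsmul T Q ∘ₗ s) ∘ₗ h.restrictScalars T, ?_⟩
    ext p
    have := LinearMap.congr_fun hh p
    simp only [LinearMap.comp_apply, LinearMap.coe_mk, AddHom.coe_mk] at this
    simp only [LinearMap.comp_apply, LinearMap.restrictScalars_apply, this,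
      TensorProduct.lift.tmul, LinearMap.lsmul_apply]
    rw [← map_smul, ← algebraMap_smul A (s 1) p, hs1, one_smul]

end IsStronglyGorensteinProjective

section SquareZero

variable {K A M : Type u} [Field K] [CommRing A] [Algebra K A] [AddCommGroup M] [Module A M]

/-- A `K`-linear endomorphism `σ` of `M` with `σ² = 1`, `σ x = x` and `x σ = -x`, for `x` acting
on `M` with square zero: it is `1` on the kernel of `x` and `-1` on a complement. -/
theorem exists_involution_of_sq_eq_zero [Module K M] [IsScalarTower K A M] {x : A}
    (hx : x * x = 0) :
    ∃ σ : M →ₗ[K] M, (∀ m, σ (σ m) = m) ∧ (∀ m, σ (x • m) = x • m) ∧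
      ∀ m, x • σ m = -(x • m) := by
  obtain ⟨r, hr⟩ := (LinearMap.ker (Algebra.lsmul K K M x)).subtype.exists_leftInverse_of_injective
    (Submodule.ker_subtype _)
  have hker (m : LinearMap.ker (Algebra.lsmul K K M x)) : x • (m : M) = 0 := m.2
  have hrm (m : M) (hm : x • m = 0) : (r m : M) = m :=
    congrArg Subtype.val (LinearMap.congr_fun hr ⟨m, hm⟩)
  let p : M →ₗ[K] M := (LinearMap.ker (Algebra.lsmul K K M x)).subtype ∘ₗ r
  have hxp (m : M) : x • p m = 0 := hker (r m)
  have hp (m : M) (hm : x • m = 0) : p m = m := hrm m hm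
  refine ⟨p + p - LinearMap.id, fun m => ?_, fun m => ?_, fun m => ?_⟩
  · simp only [LinearMap.sub_apply, LinearMap.add_apply, LinearMap.id_apply, map_sub, map_add,
      hp _ (hxp m)]
    abel
  · simp [hp _ (show x • x • m = 0 by rw [smul_smul, hx, zero_smul])]
  · simp [smul_sub, hxp]

/-- If `x * x = 0` and multiplication by `x` on `A` has a contracting homotopy `π`, then every
projective module over `A` has such a homotopy. -/
theorem Module.Projective.exists_homotopy [Module K M] [IsScalarTower K A M]
    [Module.Projective A M] {x : A} (π : A →ₗ[K] A) (hπ : ∀ a, π (x * a) + x * π a = a) :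
    ∃ τ : M →ₗ[K] M, ∀ m, τ (x • m) + x • τ m = m := by
  obtain ⟨s, hs⟩ := Module.projective_def'.mp ‹Module.Projective A M›
  refine ⟨(Finsupp.linearCombination A id).restrictScalars K ∘ₗ
    Finsupp.mapRange.linearMap π ∘ₗ s.restrictScalars K, fun m => ?_⟩
  have key (u : M →₀ A) : Finsupp.mapRange.linearMap π (x • u) +
      x • Finsupp.mapRange.linearMap π u = u := by
    ext i
    simp [hπ]
  have := LinearMap.congr_fun hs m
  simp only [LinearMap.comp_apply, LinearMap.id_apply] at this
  simp only [LinearMap.comp_apply, LinearMap.restrictScalars_apply, map_smul]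
  rw [← map_smul (Finsupp.linearCombination A id), ← map_add, key, this]

/-- The `A`-linear trace of a `K`-linear map when `A` is spanned by `1` and `x`. -/
theorem exists_linearMap_trace {P Q : Type*} [AddCommGroup P] [Module A P] [Module K P]
    [AddCommGroup Q] [Module A Q] [Module K Q] [IsScalarTower K A P] [IsScalarTower K A Q]
    {x : A} (hx : x * x = 0) (hspan : ∀ a : A, ∃ b c : K, a = algebraMap K A b + c • x)
    (u : P →ₗ[K] Q) : ∃ h : P →ₗ[A] Q, ∀ p, h p = u (x • p) + x • u p := by
  refine ⟨{ toFun := fun p => u (x • p) + x • u p, map_add' := ?_, map_smul' := ?_ }, fun _ => rfl⟩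
  · intro p q
    simp only [smul_add, map_add]
    abel
  · intro a p
    obtain ⟨b, c, rfl⟩ := hspan a
    have hxP : x • x • p = 0 := by rw [smul_smul, hx, zero_smul]
    have hxQ : x • x • u p = 0 := by rw [smul_smul, hx, zero_smul]
    simp only [add_smul, smul_add, algebraMap_smul, smul_assoc, map_add, map_smul, hxP, hxQ,
      smul_comm x b, smul_comm x c, smul_zero, add_zero, RingHom.id_apply]
    abel

theorem IsStronglyGorensteinProjective.of_sq_eq_zero {x : A} (hx : x * x = 0)
    (hspan : ∀ a : A, ∃ b c : K, a = algebraMap K A b + c • x)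
    (π : A →ₗ[K] A) (hπ1 : π 1 = 0) (hπx : π x = 1) :
    IsStronglyGorensteinProjective A M := by
  let _ : Module K M := Module.compHom M (algebraMap K A)
  have : IsScalarTower K A M := ⟨fun t a p => by rw [Algebra.smul_def, mul_smul]; rfl⟩
  have hπ (a : A) : π (x * a) + x * π a = a := by
    obtain ⟨b, c, rfl⟩ := hspan a
    simp [mul_add, hx, Algebra.algebraMap_eq_smul_one, hπ1, hπx]
  obtain ⟨σ, hσσ, hσx, hxσ⟩ := exists_involution_of_sq_eq_zero (K := K) (M := M) hx
  let f : A ⊗[K] M →ₗ[A] A ⊗[K] M :=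
    (Algebra.lsmul K K M x).baseChange A + x • σ.baseChange A
  have hf (a : A) (m : M) : f (a ⊗ₜ m) = a ⊗ₜ (x • m) + (x * a) ⊗ₜ σ m := by
    simp [f, TensorProduct.smul_tmul']
  let s : A ⊗[K] M →ₗ[K] A ⊗[K] M := TensorProduct.map π σ
  have hxx (m : M) : x • x • m = 0 := by rw [smul_smul, hx, zero_smul]
  have hff (t : A ⊗[K] M) : f (f t) = 0 := by
    induction t with
    | zero => simp
    | add a b ha hb => simp [ha, hb]
    | tmul a m => simp [hf, hσx, hxσ, hxx, ← mul_assoc, hx, TensorProduct.tmul_neg]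
  have hfs (t : A ⊗[K] M) : f (s t) + s (f t) = t := by
    induction t with
    | zero => simp
    | add a b ha hb =>
      simp only [map_add]
      rw [add_add_add_comm, ha, hb]
    | tmul a m =>
      simp only [s, hf, TensorProduct.map_tmul, map_add, hσx, hxσ, hσσ, TensorProduct.tmul_neg]
      conv_rhs => rw [← hπ a, TensorProduct.add_tmul]
      abel
  let ι : M →ₗ[A] A ⊗[K] M :=
    { toFun := fun m => f (1 ⊗ₜ m)
      map_add' := fun m n => by rw [TensorProduct.tmul_add, map_add]
      map_smul' := fun a m => by
        obtain ⟨b, c, rfl⟩ := hspan a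
        have h1 : f (1 ⊗ₜ (x • m)) = x • f (1 ⊗ₜ m) := by
          simp [hf, hσx, hxx, hx, TensorProduct.smul_tmul']
        simp only [add_smul, TensorProduct.tmul_add, map_add, algebraMap_smul, smul_assoc,
          TensorProduct.tmul_smul, RingHom.id_apply, LinearMap.map_smul_of_tower, h1] }
  let μ : A ⊗[K] M →ₗ[A] M := LinearMap.liftBaseChange A LinearMap.id
  have hι : Function.Injective ι := by
    refine Function.LeftInverse.injective (g := fun t => μ (s t)) fun m => ?_
    have h1 : s (f (1 ⊗ₜ m)) = 1 ⊗ₜ m := by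
      simpa [s, hπ1] using hfs (1 ⊗ₜ m)
    change μ (s (f (1 ⊗ₜ m))) = m
    simp [h1, μ]
  have hr : LinearMap.range f = LinearMap.range ι := by
    have hfμ : f = ι ∘ₗ μ := by
      ext m
      simp [ι, μ]
    rw [hfμ]
    exact LinearMap.range_comp_of_range_eq_top _
      (LinearMap.range_eq_top.mpr fun m => ⟨1 ⊗ₜ m, by simp [μ]⟩)
  refine ⟨A ⊗[K] M, _, _, f, inferInstance, ?_,
    ⟨(LinearEquiv.ofInjective ι hι).trans (LinearEquiv.ofEq _ _ hr.symm)⟩, ?_⟩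
  · refine le_antisymm ?_ ?_
    · rintro _ ⟨t, rfl⟩
      exact hff t
    · intro t ht
      refine ⟨s t, ?_⟩
      have := hfs t
      rwa [LinearMap.mem_ker.mp ht, map_zero, add_zero] at this
  · intro Q _ _ _ g hg
    let _ : Module K Q := Module.compHom Q (algebraMap K A)
    have : IsScalarTower K A Q := ⟨fun t a p => by rw [Algebra.smul_def, mul_smul]; rfl⟩
    obtain ⟨τ, hτ⟩ := Module.Projective.exists_homotopy (M := Q) π hπ
    obtain ⟨h, hh⟩ := exists_linearMap_trace hx hspan (τ ∘ₗ g.restrictScalars K ∘ₗ s)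
    have hgs (t : A ⊗[K] M) : g (s (f t)) = g t := by
      have h0 : g (f (s t)) = 0 := LinearMap.congr_fun hg (s t)
      conv_rhs => rw [← hfs t, map_add, h0, zero_add]
    refine ⟨h, LinearMap.ext fun t => ?_⟩
    simp only [LinearMap.comp_apply, hh, LinearMap.restrictScalars_apply, ← map_smul f, hgs]
    rw [map_smul g, hτ]

end SquareZero

/-- Over a hereditary flat algebra, base change turns submodules of projectives into
projectives. -/
theorem IsHereditaryRing.projective_baseChange {T S P : Type u} [CommRing T] [CommRing S]
    [Algebra T S] [Module.Flat T S] (hS : IsHereditaryRing S) [AddCommGroup P] [Module T P]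
    [Module.Projective T P] (N : Submodule T P) : Module.Projective S (S ⊗[T] N) := by
  have hinj : Function.Injective (N.subtype.baseChange S) :=
    Module.Flat.lTensor_preserves_injective_linearMap (M := S) N.subtype N.injective_subtype
  have := hS (S ⊗[T] P) _ _ inferInstance (LinearMap.range (N.subtype.baseChange S))
  exact Module.Projective.of_equiv' (LinearEquiv.ofInjective _ hinj).symm

/-- A product of a ring over which every module is strongly Gorenstein projective and a
hereditary ring is strongly Gorenstein hereditary. -/
theorem IsSGHereditaryRing.of_bijective_algebraMap_prod {T A S : Type u} [CommRing T]
    [CommRing A] [CommRing S] [Algebra T A] [Algebra T S]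
    (hT : Function.Bijective (algebraMap T (A × S)))
    (hA : ∀ (M : Type u) [AddCommGroup M] [Module A M], IsStronglyGorensteinProjective A M)
    (hS : IsHereditaryRing S) : IsSGHereditaryRing T := by
  intro P _ _ hP N
  let e : T ≃ₗ[T] A × S := LinearEquiv.ofBijective (Algebra.linearMap T (A × S)) hT
  have : Module.Projective T (A × S) := Module.Projective.of_equiv' e
  have : Module.Projective T A := .of_split (LinearMap.inl T A S) (LinearMap.fst T A S)
    (LinearMap.fst_comp_inl T A S)
  have : Module.Projective T S := .of_split (LinearMap.inr T A S) (LinearMap.snd T A S)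
    (LinearMap.snd_comp_inr T A S)
  have hTA : Function.Surjective (algebraMap T A) := Prod.fst_surjective.comp hT.surjective
  have := hS.projective_baseChange N
  have : Module.Projective T (S ⊗[T] N) := .of_algebra (A := S)
  have hprod := (IsStronglyGorensteinProjective.of_algebra hTA (hA (A ⊗[T] N))).prod
    (.of_projective (S ⊗[T] N))
  exact hprod.of_equiv_s8 ((TensorProduct.lid T N).symm ≪≫ₗ
    TensorProduct.congr e (LinearEquiv.refl T N) ≪≫ₗ TensorProduct.prodLeft T T A S N)

theorem IsSGHereditaryRing.prod {A S : Type u} [CommRing A] [CommRing S]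
    (hA : ∀ (M : Type u) [AddCommGroup M] [Module A M], IsStronglyGorensteinProjective A M)
    (hS : IsHereditaryRing S) : IsSGHereditaryRing (A × S) := by
  let _ : Algebra (A × S) A := (RingHom.fst A S).toAlgebra
  let _ : Algebra (A × S) S := (RingHom.snd A S).toAlgebra
  exact .of_bijective_algebraMap_prod (A := A) (S := S) Function.bijective_id hA hS

theorem Ideal.eq_zero_of_projective_span_singleton {T : Type*} [CommRing T] {x : T}
    (hx : x * x = 0) [Module.Projective T (Ideal.span {x})] : x = 0 := by
  obtain ⟨s, hs⟩ := (LinearMap.toSpanSingleton T (Ideal.span {x})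
    ⟨x, Ideal.mem_span_singleton_self x⟩).exists_rightInverse_of_surjective (by
      rw [LinearMap.range_eq_top]
      rintro ⟨y, hy⟩
      obtain ⟨a, rfl⟩ := Ideal.mem_span_singleton'.mp hy
      exact ⟨a, rfl⟩)
  have h1 : s ⟨x, Ideal.mem_span_singleton_self x⟩ * x = x :=
    congrArg Subtype.val (LinearMap.congr_fun hs ⟨x, Ideal.mem_span_singleton_self x⟩)
  have h2 : x • (⟨x, Ideal.mem_span_singleton_self x⟩ : Ideal.span {x}) = 0 := Subtype.ext hx
  rw [← h1, mul_comm, ← smul_eq_mul, ← map_smul, h2, map_zero]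

/-- Example 2.9(1): `K[X]/(X²) × S` is strongly Gorenstein hereditary but not hereditary,
for `K` a field and `S` a non-Noetherian hereditary ring. -/
theorem statement_8 (K : Type u) [Field K] (S : Type u) [CommRing S]
    (hS : IsHereditaryRing S) (hS' : ¬ IsNoetherianRing S) :
    IsSGHereditaryRing ((Polynomial K ⧸ Ideal.span {(Polynomial.X : Polynomial K) ^ 2}) × S) ∧
    ¬ IsHereditaryRing
      ((Polynomial K ⧸ Ideal.span {(Polynomial.X : Polynomial K) ^ 2}) × S) := by
  have hX : (Ideal.Quotient.mk (Ideal.span {(Polynomial.X : Polynomial K) ^ 2}) Polynomial.X) *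
      Ideal.Quotient.mk _ Polynomial.X = 0 := by
    rw [← map_mul, ← pow_two, Ideal.Quotient.eq_zero_iff_mem]
    exact Ideal.mem_span_singleton_self _
  have hX0 : Ideal.Quotient.mk (Ideal.span {(Polynomial.X : Polynomial K) ^ 2})
      Polynomial.X ≠ 0 := by
    rw [Ne, Ideal.Quotient.eq_zero_iff_mem, Ideal.mem_span_singleton, Polynomial.X_pow_dvd_iff]
    intro h
    simpa using h 1 one_lt_two
  have hmonic : (Polynomial.X ^ 2 : Polynomial K).Monic := Polynomial.monic_X_pow 2
  have hmod (p : Polynomial K) (hp : p.degree < 2) : p %ₘ (Polynomial.X ^ 2) = p := by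
    rw [Polynomial.modByMonic_eq_self_iff hmonic]
    simpa using hp
  refine ⟨.prod (fun M _ _ => ?_) hS, fun h => ?_⟩
  · let c (i : ℕ) : (Polynomial K ⧸ Ideal.span {(Polynomial.X : Polynomial K) ^ 2}) →ₗ[K] K :=
      Polynomial.lcoeff K i ∘ₗ AdjoinRoot.modByMonicHom hmonic
    refine .of_sq_eq_zero hX (fun a => ⟨c 0 a, c 1 a, ?_⟩)
      ((Algebra.linearMap K _) ∘ₗ c 1) ?_ ?_
    · have hdeg : (AdjoinRoot.modByMonicHom hmonic a).degree ≤ 1 := by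
        obtain ⟨p, rfl⟩ := Ideal.Quotient.mk_surjective a
        have := Polynomial.degree_modByMonic_lt p hmonic
        rw [Polynomial.degree_X_pow] at this
        exact Order.le_of_lt_succ this
      have ha := AdjoinRoot.mk_leftInverse hmonic a
      rw [Polynomial.eq_X_add_C_of_degree_le_one hdeg] at ha
      rw [Algebra.smul_def, add_comm]
      exact ha.symm.trans (by rw [map_add, map_mul]; rfl)
    · have h1 : c 1 1 = 0 := by
        change ((1 : Polynomial K) %ₘ (Polynomial.X ^ 2)).coeff 1 = 0
        rw [hmod _ (by simp), Polynomial.coeff_one]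
        simp
      simp [h1]
    · have h1 : c 1 (Ideal.Quotient.mk _ Polynomial.X) = 1 := by
        change ((Polynomial.X : Polynomial K) %ₘ (Polynomial.X ^ 2)).coeff 1 = 1
        rw [hmod _ (by rw [Polynomial.degree_X]; exact Nat.one_lt_ofNat), Polynomial.coeff_X_one]
      simp [h1]
  · have := h _ _ _ inferInstance (Ideal.span {(Ideal.Quotient.mk _ Polynomial.X, (0 : S))})
    have h0 := Ideal.eq_zero_of_projective_span_singleton
      (x := (Ideal.Quotient.mk (Ideal.span {(Polynomial.X : Polynomial K) ^ 2}) Polynomial.X,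
        (0 : S))) (Prod.ext hX (mul_zero 0))
    exact hX0 (congrArg Prod.fst h0)
end
end
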